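/- arXiv:2003.05338 — 2 statements merged into one kernel-verified Lean document; each statement's English description precedes it below -/
import Mathlib

section
/- Let t ≥ 1, let μ, ν ∈ P_t(ℝ^d), and let θ : ℝ^d → ℝ be a convex continuous function, bounded from below, with |θ(x)| ≤ K(1+|x|^t) for some constant K. Define C_{θ,icx}(x,p) := inf_{q ≤_icx p} θ( x − ∫ y q(dy) ) and R_θφ(x) := inf_{ y ≤ z, z ∈ ℝ^d } ( φ(z) + θ(x − y) ). Then the following four values coincide: (i) inf_{π ∈ Π(μ,ν)} ∫_{ℝ^d} C_{θ,icx}(x, π_x) μ(dx); (ii) inf_{ ν̃ ≤_icx ν } inf_{π ∈ Π(μ,ν̃)} ∫ θ(x−y) π(dx,dy); (iii) inf_{ μ ≤_icx μ̃, ν̃ ≤_icx ν } inf_{π ∈ Π(μ̃,ν̃)} ∫ θ(x−y) π(dx,dy); (iv) sup_{ φ ∈ Φ_t^{icx}(ℝ^d) } ( −ν(φ) + ∫_{ℝ^d} R_θφ(x) μ(dx) ). -/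
open MeasureTheory ProbabilityTheory ENNReal NNReal

noncomputable section

variable {d : ℕ}

/-- Finite `t`-th moment. -/
def MomT (t : ℝ) (p : ProbabilityMeasure (Fin d → ℝ)) : Prop :=
  Integrable (fun x => ‖x‖ ^ t) (p : Measure (Fin d → ℝ))

/-- Finite first moment. -/
def Mom1 (p : ProbabilityMeasure (Fin d → ℝ)) : Prop :=
  Integrable (fun x => ‖x‖) (p : Measure (Fin d → ℝ))

/-- The increasing convex order `p ≤_icx q`: `∫ f dp ≤ ∫ f dq` for every increasing
(w.r.t. the coordinatewise order) convex function `f` of at most linear growth. -/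
def IcxLE (p q : ProbabilityMeasure (Fin d → ℝ)) : Prop :=
  ∀ f : (Fin d → ℝ) → ℝ, Monotone f → ConvexOn ℝ Set.univ f →
    (∃ K : ℝ, ∀ x, |f x| ≤ K * (1 + ‖x‖)) →
    ∫ x, f x ∂(p : Measure (Fin d → ℝ)) ≤ ∫ x, f x ∂(q : Measure (Fin d → ℝ))

/-- `π` is a coupling of `μ` and `ν`. -/
def IsCoupling (μ ν : ProbabilityMeasure (Fin d → ℝ))
    (π : ProbabilityMeasure ((Fin d → ℝ) × (Fin d → ℝ))) : Prop :=
  (π : Measure ((Fin d → ℝ) × (Fin d → ℝ))).map Prod.fst = (μ : Measure (Fin d → ℝ)) ∧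
    (π : Measure ((Fin d → ℝ) × (Fin d → ℝ))).map Prod.snd = (ν : Measure (Fin d → ℝ))

/-- The nonnegative part of an extended real number, as an element of `ℝ≥0∞`. -/
noncomputable def ERealToENNReal (x : EReal) : ℝ≥0∞ :=
  if x = ⊤ then ⊤ else ENNReal.ofReal x.toReal

/-- Integral of a real-valued function, with values in `[-∞,+∞]`. -/
noncomputable def eInt {α : Type*} [MeasurableSpace α] (m : Measure α) (h : α → ℝ) : EReal :=
  ((∫⁻ a, ENNReal.ofReal (h a) ∂m : ℝ≥0∞) : EReal) -
    ((∫⁻ a, ENNReal.ofReal (-(h a)) ∂m : ℝ≥0∞) : EReal)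

/-- Integral of an `EReal`-valued function: positive part minus negative part. -/
noncomputable def eIntE {α : Type*} [MeasurableSpace α] (m : Measure α)
    (h : α → EReal) : EReal :=
  ((∫⁻ a, ERealToENNReal (h a) ∂m : ℝ≥0∞) : EReal) -
    ((∫⁻ a, ERealToENNReal (-(h a)) ∂m : ℝ≥0∞) : EReal)

/-- The cost `C_{θ,icx}(x,p) = inf_{q ≤_icx p} θ(x - ∫ y q(dy))`. -/
noncomputable def Cicx (θ : (Fin d → ℝ) → ℝ) (x : Fin d → ℝ)
    (p : ProbabilityMeasure (Fin d → ℝ)) : ℝ :=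
  ⨅ q : {q : ProbabilityMeasure (Fin d → ℝ) // Mom1 q ∧ IcxLE q p},
    θ (x - ∫ y, y ∂((q.1 : Measure (Fin d → ℝ))))

/-- The inf-convolution `R_θ φ(x) = inf_{y ≤ z} (φ(z) + θ(x-y))`. -/
noncomputable def Rtheta (θ φ : (Fin d → ℝ) → ℝ) (x : Fin d → ℝ) : EReal :=
  ⨅ (y : Fin d → ℝ) (z : Fin d → ℝ) (_ : y ≤ z), ((φ z + θ (x - y) : ℝ) : EReal)

/-! ### Extended integrals -/

theorem eInt_eq_coe_integral {α : Type*} [MeasurableSpace α] {m : Measure α} {h : α → ℝ}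
    (hh : Integrable h m) : eInt m h = ((∫ a, h a ∂m : ℝ) : EReal) := by
  have h1 : (∫⁻ a, ENNReal.ofReal (h a) ∂m) ≠ ⊤ := hh.lintegral_lt_top.ne
  have h2 : (∫⁻ a, ENNReal.ofReal (-(h a)) ∂m) ≠ ⊤ := hh.neg.lintegral_lt_top.ne
  rw [eInt, integral_eq_lintegral_pos_part_sub_lintegral_neg_part hh, EReal.coe_sub,
    EReal.coe_ennreal_toReal h1, EReal.coe_ennreal_toReal h2]

theorem eInt_eq_top {α : Type*} [MeasurableSpace α] {m : Measure α} [IsFiniteMeasure m]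
    {h : α → ℝ} (hm : AEStronglyMeasurable h m) {c : ℝ} (hc : ∀ a, c ≤ h a)
    (hh : ¬ Integrable h m) : eInt m h = ⊤ := by
  have hneg : (∫⁻ a, ENNReal.ofReal (-(h a)) ∂m) ≠ ⊤ := by
    refine ne_top_of_le_ne_top ?_ (lintegral_mono (g := fun _ => ENNReal.ofReal (-c))
      fun a => ENNReal.ofReal_le_ofReal (neg_le_neg (hc a)))
    simpa using ENNReal.mul_ne_top ENNReal.ofReal_ne_top (measure_ne_top m _)
  have hpos : (∫⁻ a, ENNReal.ofReal (h a) ∂m) = ⊤ := by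
    by_contra hfin
    apply hh
    have hsub : Integrable (fun a => h a - c) m := by
      refine (lintegral_ofReal_ne_top_iff_integrable (hm.sub aestronglyMeasurable_const)
        (Filter.Eventually.of_forall fun a => sub_nonneg.2 (hc a))).1 ?_
      refine ne_top_of_le_ne_top ?_ (lintegral_mono
        (g := fun a => ENNReal.ofReal (h a) + ENNReal.ofReal (-c)) fun a => ?_)
      · rw [lintegral_add_right _ measurable_const]
        refine ENNReal.add_ne_top.2 ⟨hfin, ?_⟩
        simpa using ENNReal.mul_ne_top ENNReal.ofReal_ne_top (measure_ne_top m _)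
      · rw [sub_eq_add_neg]
        exact ENNReal.ofReal_add_le
    exact (hsub.add (integrable_const c)).congr (Filter.Eventually.of_forall fun a => by simp)
  rw [eInt, hpos, ← EReal.coe_ennreal_toReal hneg, EReal.coe_ennreal_top, EReal.top_sub_coe]

theorem eInt_congr_ae {α : Type*} [MeasurableSpace α] {m : Measure α} {g h : α → ℝ}
    (hgh : g =ᵐ[m] h) : eInt m g = eInt m h := by
  unfold eInt
  congr 2
  · exact lintegral_congr_ae (hgh.mono fun a ha => by simp only [ha])
  · exact lintegral_congr_ae (hgh.mono fun a ha => by simp only [ha])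

theorem eIntE_coe {α : Type*} [MeasurableSpace α] (m : Measure α) (h : α → ℝ) :
    eIntE m (fun a => (h a : EReal)) = eInt m h := by
  have (x : ℝ) : ERealToENNReal (-(x : EReal)) = ENNReal.ofReal (-x) := by
    rw [← EReal.coe_neg, ERealToENNReal, if_neg (EReal.coe_ne_top _), EReal.toReal_coe]
  simp only [eIntE, eInt, this]
  simp [ERealToENNReal]

theorem eIntE_bot {α : Type*} [MeasurableSpace α] (m : Measure α) [IsProbabilityMeasure m] :
    eIntE m (fun _ => ⊥) = ⊥ := by
  simp [eIntE, ERealToENNReal]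

/-! ### Moments and growth -/

theorem norm_le_one_add_rpow {t : ℝ} (ht : 1 ≤ t) (x : Fin d → ℝ) : ‖x‖ ≤ 1 + ‖x‖ ^ t := by
  rcases le_total ‖x‖ 1 with h | h
  · exact h.trans (le_add_of_nonneg_right (Real.rpow_nonneg (norm_nonneg _) _))
  · exact (Real.self_le_rpow_of_one_le h ht).trans (le_add_of_nonneg_left zero_le_one)

theorem MomT.mom1 {t : ℝ} (ht : 1 ≤ t) {p : ProbabilityMeasure (Fin d → ℝ)} (h : MomT t p) :
    Mom1 p :=
  ((integrable_const 1).add h).mono' continuous_norm.aestronglyMeasurable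
    (Filter.Eventually.of_forall fun x => by simpa using norm_le_one_add_rpow ht x)

theorem Mom1.integrable_id {p : ProbabilityMeasure (Fin d → ℝ)} (h : Mom1 p) :
    Integrable (fun x => x) (p : Measure (Fin d → ℝ)) :=
  (integrable_norm_iff continuous_id.aestronglyMeasurable).1 h

theorem MomT.integrable {t : ℝ} {p : ProbabilityMeasure (Fin d → ℝ)} (h : MomT t p)
    {f : (Fin d → ℝ) → ℝ} (hf : Continuous f) {K : ℝ} (hK : ∀ x, |f x| ≤ K * (1 + ‖x‖ ^ t)) :
    Integrable f (p : Measure (Fin d → ℝ)) :=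
  (((integrable_const 1).add h).const_mul K).mono' hf.aestronglyMeasurable
    (Filter.Eventually.of_forall fun x => by simpa using hK x)

theorem Mom1.integrable {p : ProbabilityMeasure (Fin d → ℝ)} (h : Mom1 p)
    {f : (Fin d → ℝ) → ℝ} (hf : Continuous f) {K : ℝ} (hK : ∀ x, |f x| ≤ K * (1 + ‖x‖)) :
    Integrable f (p : Measure (Fin d → ℝ)) :=
  (((integrable_const 1).add h).const_mul K).mono' hf.aestronglyMeasurable
    (Filter.Eventually.of_forall fun x => by simpa using hK x)

theorem Mom1.integrable_affine {p : ProbabilityMeasure (Fin d → ℝ)} (h : Mom1 p)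
    (l : (Fin d → ℝ) →L[ℝ] ℝ) (c : ℝ) :
    Integrable (fun x => l x + c) (p : Measure (Fin d → ℝ)) :=
  (l.integrable_comp h.integrable_id).add (integrable_const c)

theorem ConvexOn.continuous_of_univ {f : (Fin d → ℝ) → ℝ} (hf : ConvexOn ℝ Set.univ f) :
    Continuous f :=
  hf.locallyLipschitz.continuous

/-! ### Affine minorants of convex functions -/

theorem nonneg_of_forall_le_add_mul {a b x : ℝ} (h : ∀ s : ℝ, 0 ≤ s → a ≤ b + s * x) : 0 ≤ x := by
  by_contra! hx
  have hab := h 0 le_rfl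
  have h1 := h ((b - a + 1) / (-x)) (div_nonneg (by linarith) (by linarith))
  have h2 : (b - a + 1) / (-x) * x = -(b - a + 1) := by
    rw [div_mul_eq_mul_div, div_neg, mul_div_assoc, div_self hx.ne, mul_one]
  linarith

theorem nonneg_of_affine_le_monotone {f : (Fin d → ℝ) → ℝ} (hf : Monotone f)
    {l : (Fin d → ℝ) →L[ℝ] ℝ} {c : ℝ} (h : ∀ x, l x + c ≤ f x) {v : Fin d → ℝ} (hv : 0 ≤ v) :
    0 ≤ l v := by
  refine nonneg_of_forall_le_add_mul (a := c) (b := f 0) fun s hs => ?_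
  have h1 := h (-(s • v))
  have h2 : f (-(s • v)) ≤ f 0 := hf (neg_nonpos.2 (smul_nonneg hs hv))
  simp only [map_neg, map_smul, smul_eq_mul] at h1
  linarith

theorem ContinuousLinearMap.monotone_of_nonneg {l : (Fin d → ℝ) →L[ℝ] ℝ}
    (h : ∀ v, 0 ≤ v → 0 ≤ l v) : Monotone l := fun x y hxy => by
  have := h (y - x) (sub_nonneg.2 hxy)
  rw [map_sub] at this
  linarith

theorem exists_affine_seq {f : (Fin d → ℝ) → ℝ} (hf : ConvexOn ℝ Set.univ f) :
    ∃ (l : ℕ → (Fin d → ℝ) →L[ℝ] ℝ) (c : ℕ → ℝ), (∀ i x, l i x + c i ≤ f x) ∧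
      ∀ x, ⨆ i, (l i x + c i) = f x := by
  obtain ⟨l, c, h1, h2⟩ := hf.univ_sSup_of_nat_affine_eq (𝕜 := ℝ)
    hf.continuous_of_univ.lowerSemicontinuous
  refine ⟨l, c, fun i x => h1 i x, fun x => ?_⟩
  have hbdd : BddAbove (Set.range fun i => RCLike.re ∘ (l i) + Function.const (Fin d → ℝ) (c i)) :=
    ⟨f, by rintro _ ⟨i, rfl⟩; exact h1 i⟩
  have := congrFun h2 x
  rw [iSup_apply] at this
  simpa using this

theorem exists_affine_minorant {f : (Fin d → ℝ) → ℝ} (hf : ConvexOn ℝ Set.univ f) :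
    ∃ (l : (Fin d → ℝ) →L[ℝ] ℝ) (c : ℝ), ∀ x, l x + c ≤ f x := by
  obtain ⟨l, c, h, -⟩ := exists_affine_seq hf
  exact ⟨l 0, c 0, h 0⟩

theorem convexOn_affine (l : (Fin d → ℝ) →L[ℝ] ℝ) (c : ℝ) :
    ConvexOn ℝ Set.univ (fun x => l x + c) :=
  (l.toLinearMap.convexOn convex_univ).add (convexOn_const c convex_univ)

theorem abs_affine_le (l : (Fin d → ℝ) →L[ℝ] ℝ) (c : ℝ) (x : Fin d → ℝ) :
    |l x + c| ≤ (‖l‖ + |c|) * (1 + ‖x‖) := by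
  have h1 : |l x| ≤ ‖l‖ * ‖x‖ := l.le_opNorm x
  have h2 := abs_add_le (l x) c
  nlinarith [norm_nonneg l, norm_nonneg x, abs_nonneg c, mul_nonneg (abs_nonneg c) (norm_nonneg x)]

/-! ### The increasing convex order tests convex functions of arbitrary growth -/

theorem partialSups_affine_test (l : ℕ → (Fin d → ℝ) →L[ℝ] ℝ) (c : ℕ → ℝ)
    (hl : ∀ i, Monotone (l i)) (n : ℕ) :
    Monotone (partialSups (fun i x => l i x + c i) n) ∧
      ConvexOn ℝ Set.univ (partialSups (fun i x => l i x + c i) n) ∧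
      ∃ K : ℝ, ∀ x, |partialSups (fun i x => l i x + c i) n x| ≤ K * (1 + ‖x‖) := by
  induction n with
  | zero =>
    rw [partialSups_zero]
    exact ⟨(hl 0).add_const _, convexOn_affine _ _, _, abs_affine_le _ _⟩
  | succ n ih =>
    obtain ⟨h1, h2, K, hK⟩ := ih
    rw [partialSups_add_one]
    refine ⟨h1.sup ((hl _).add_const _), h2.sup (convexOn_affine _ _),
      max K (‖l (n + 1)‖ + |c (n + 1)|), fun x => ?_⟩
    have hx : 0 ≤ 1 + ‖x‖ := by positivity
    refine (abs_max_le_max_abs_abs).trans (max_le ((hK x).trans ?_)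
      ((abs_affine_le _ _ x).trans ?_))
    · exact mul_le_mul_of_nonneg_right (le_max_left _ _) hx
    · exact mul_le_mul_of_nonneg_right (le_max_right _ _) hx

theorem IcxLE.integrable_and_integral_le {p q : ProbabilityMeasure (Fin d → ℝ)} (hpq : IcxLE p q)
    (hp : Mom1 p) (hq : Mom1 q) {f : (Fin d → ℝ) → ℝ} (hmono : Monotone f)
    (hf : ConvexOn ℝ Set.univ f) (hfq : Integrable f (q : Measure (Fin d → ℝ))) :
    Integrable f (p : Measure (Fin d → ℝ)) ∧
      ∫ x, f x ∂(p : Measure (Fin d → ℝ)) ≤ ∫ x, f x ∂(q : Measure (Fin d → ℝ)) := by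
  obtain ⟨l, c, hle, hsup⟩ := exists_affine_seq hf
  have hl (i) : Monotone (l i) :=
    ContinuousLinearMap.monotone_of_nonneg fun v hv => nonneg_of_affine_le_monotone hmono (hle i) hv
  set F := partialSups (fun i x => l i x + c i) with hF
  have hFx (n x) : F n x = partialSups (fun i => l i x + c i) n := Pi.partialSups_apply _ _ _
  have hFle (n x) : F n x ≤ f x := by
    rw [hFx]; exact partialSups_le _ _ _ fun i _ => hle i x
  have hFmono (x) : Monotone fun n => F n x := fun m n hmn => F.mono hmn x
  have hFlim (x) : Filter.Tendsto (fun n => F n x) Filter.atTop (nhds (f x)) := by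
    have := tendsto_atTop_ciSup (hFmono x) ⟨f x, by rintro _ ⟨n, rfl⟩; exact hFle n x⟩
    simpa only [hFx, ciSup_partialSups_eq', hsup] using this
  have hFp (n) : Integrable (F n) (p : Measure (Fin d → ℝ)) := by
    obtain ⟨-, h2, K, hK⟩ := partialSups_affine_test l c hl n
    exact hp.integrable h2.continuous_of_univ hK
  have hFq (n) : Integrable (F n) (q : Measure (Fin d → ℝ)) := by
    obtain ⟨-, h2, K, hK⟩ := partialSups_affine_test l c hl n
    exact hq.integrable h2.continuous_of_univ hK
  have hFint (n) : ∫ x, F n x ∂(p : Measure (Fin d → ℝ)) ≤ ∫ x, f x ∂(q : Measure (Fin d → ℝ)) := by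
    obtain ⟨h1, h2, h3⟩ := partialSups_affine_test l c hl n
    exact (hpq _ h1 h2 h3).trans (integral_mono (hFq n) hfq (hFle n))
  have hdiff : Integrable (fun x => f x - F 0 x) (p : Measure (Fin d → ℝ)) := by
    refine (lintegral_ofReal_ne_top_iff_integrable
      (hf.continuous_of_univ.aestronglyMeasurable.sub (hFp 0).1)
      (Filter.Eventually.of_forall fun x => sub_nonneg.2 (hFle 0 x))).1 ?_
    have hlim := lintegral_tendsto_of_tendsto_of_monotone (μ := (p : Measure (Fin d → ℝ)))
      (f := fun n x => ENNReal.ofReal (F n x - F 0 x))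
      (F := fun x => ENNReal.ofReal (f x - F 0 x))
      (fun n => ((hFp n).1.aemeasurable.sub (hFp 0).1.aemeasurable).ennreal_ofReal)
      (Filter.Eventually.of_forall fun x m n hmn =>
        ENNReal.ofReal_le_ofReal (sub_le_sub_right (hFmono x hmn) _))
      (Filter.Eventually.of_forall fun x =>
        (ENNReal.continuous_ofReal.tendsto _).comp ((hFlim x).sub_const _))
    refine ne_top_of_le_ne_top ENNReal.ofReal_ne_top (le_of_tendsto'
      (b := ENNReal.ofReal (∫ x, f x ∂(q : Measure (Fin d → ℝ)) -
        ∫ x, F 0 x ∂(p : Measure (Fin d → ℝ)))) hlim fun n => ?_)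
    rw [← ofReal_integral_eq_lintegral_ofReal (f := fun x => F n x - F 0 x) ((hFp n).sub (hFp 0))
      (Filter.Eventually.of_forall fun x => sub_nonneg.2 (hFmono x (Nat.zero_le n))),
      integral_sub (hFp n) (hFp 0)]
    exact ENNReal.ofReal_le_ofReal (sub_le_sub_right (hFint n) _)
  have hfp : Integrable f (p : Measure (Fin d → ℝ)) :=
    (hdiff.add (hFp 0)).congr (Filter.Eventually.of_forall fun x => by simp)
  exact ⟨hfp, le_of_tendsto' (integral_tendsto_of_tendsto_of_monotone hFp hfp
    (Filter.Eventually.of_forall hFmono) (Filter.Eventually.of_forall hFlim)) hFint⟩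

/-! ### Infima of jointly convex functions -/

theorem convexOn_iInf {F : (Fin d → ℝ) → (Fin d → ℝ) → ℝ}
    (hF : ConvexOn ℝ Set.univ fun z : (Fin d → ℝ) × (Fin d → ℝ) => F z.1 z.2)
    {S : Set (Fin d → ℝ)} (hS : Convex ℝ S) (hne : S.Nonempty)
    (hb : ∀ x, BddBelow (Set.range fun y : S => F x y)) :
    ConvexOn ℝ Set.univ fun x => ⨅ y : S, F x y := by
  have := hne.to_subtype
  refine ⟨convex_univ, fun x₁ _ x₂ _ a b ha hb' hab => le_of_forall_pos_le_add fun ε hε => ?_⟩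
  obtain ⟨y₁, h₁⟩ := exists_lt_of_ciInf_lt (lt_add_of_pos_right (⨅ y : S, F x₁ y) hε)
  obtain ⟨y₂, h₂⟩ := exists_lt_of_ciInf_lt (lt_add_of_pos_right (⨅ y : S, F x₂ y) hε)
  have h := hF.2 (Set.mem_univ (x₁, y₁.1)) (Set.mem_univ (x₂, y₂.1)) ha hb' hab
  have h' := ciInf_le (hb (a • x₁ + b • x₂)) ⟨_, hS y₁.2 y₂.2 ha hb' hab⟩
  simp only [Prod.fst_add, Prod.smul_fst, Prod.snd_add, Prod.smul_snd, smul_eq_mul] at h h' ⊢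
  have e₁ := mul_le_mul_of_nonneg_left h₁.le ha
  have e₂ := mul_le_mul_of_nonneg_left h₂.le hb'
  have e₃ : ε = a * ε + b * ε := by rw [← add_mul, hab, one_mul]
  linarith

/-! ### The increasing envelope of `θ` -/

/-- The largest increasing minorant of `θ`. -/
def Theta (θ : (Fin d → ℝ) → ℝ) (w : Fin d → ℝ) : ℝ :=
  ⨅ v : {v : Fin d → ℝ // 0 ≤ v}, θ (w + v)

theorem bddBelow_range_of_le {ι : Sort*} {g : ι → ℝ} {c : ℝ} (h : ∀ i, c ≤ g i) :
    BddBelow (Set.range g) :=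
  ⟨c, by rintro _ ⟨i, rfl⟩; exact h i⟩

section Theta

variable {θ : (Fin d → ℝ) → ℝ} {c : ℝ}

theorem Theta_le (hc : ∀ x, c ≤ θ x) (w : Fin d → ℝ) {v : Fin d → ℝ} (hv : 0 ≤ v) :
    Theta θ w ≤ θ (w + v) :=
  ciInf_le (bddBelow_range_of_le fun v : {v : Fin d → ℝ // 0 ≤ v} => hc (w + v)) ⟨v, hv⟩

theorem Theta_le_self (hc : ∀ x, c ≤ θ x) (w : Fin d → ℝ) : Theta θ w ≤ θ w := by
  simpa using Theta_le hc w le_rfl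

theorem le_Theta {a : ℝ} {w : Fin d → ℝ} (h : ∀ v, 0 ≤ v → a ≤ θ (w + v)) : a ≤ Theta θ w :=
  have : Nonempty {v : Fin d → ℝ // 0 ≤ v} := ⟨⟨0, le_rfl⟩⟩
  le_ciInf fun v => h v v.2

theorem Theta_mono (hc : ∀ x, c ≤ θ x) : Monotone (Theta θ) := fun w w' hw =>
  le_Theta fun v hv => by
    have := Theta_le hc w (v := w' - w + v) (add_nonneg (sub_nonneg.2 hw) hv)
    rwa [← add_assoc, add_sub_cancel] at this

theorem convexOn_Theta (hc : ∀ x, c ≤ θ x) (hθ : ConvexOn ℝ Set.univ θ) :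
    ConvexOn ℝ Set.univ (Theta θ) :=
  convexOn_iInf (F := fun w v => θ (w + v)) (S := Set.Ici 0)
    (hθ.comp_linearMap
      (LinearMap.fst ℝ (Fin d → ℝ) (Fin d → ℝ) + LinearMap.snd ℝ (Fin d → ℝ) (Fin d → ℝ)))
    (convex_Ici (0 : Fin d → ℝ)) ⟨0, Set.self_mem_Ici⟩ fun _ => bddBelow_range_of_le fun _ => hc _

theorem IcxLE.mean_le {p q : ProbabilityMeasure (Fin d → ℝ)} (h : IcxLE q p)
    (hq : Mom1 q) (hp : Mom1 p) :
    ∫ y, y ∂(q : Measure (Fin d → ℝ)) ≤ ∫ y, y ∂(p : Measure (Fin d → ℝ)) := by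
  intro i
  have e (m : ProbabilityMeasure (Fin d → ℝ)) (hm : Mom1 m) :
      (∫ y, y ∂(m : Measure (Fin d → ℝ))) i = ∫ y, y i ∂(m : Measure (Fin d → ℝ)) :=
    ((ContinuousLinearMap.proj (R := ℝ) (φ := fun _ : Fin d => ℝ) i).integral_comp_comm
      hm.integrable_id).symm
  rw [e q hq, e p hp]
  refine h (fun y => y i) (fun x y hxy => hxy i)
    ((LinearMap.proj (R := ℝ) (φ := fun _ : Fin d => ℝ) i).convexOn convex_univ)
    ⟨1, fun x => ?_⟩
  have := norm_le_pi_norm x i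
  rw [Real.norm_eq_abs] at this
  linarith

theorem icxLE_dirac_of_le_mean {p : ProbabilityMeasure (Fin d → ℝ)} (hp : Mom1 p)
    {m : Fin d → ℝ} (hm : m ≤ ∫ y, y ∂(p : Measure (Fin d → ℝ))) :
    IcxLE ⟨Measure.dirac m, inferInstance⟩ p := by
  intro f hf hconv ⟨K, hK⟩
  simp only [ProbabilityMeasure.coe_mk, integral_dirac]
  exact (hf hm).trans (hconv.map_integral_le hconv.continuous_of_univ.continuousOn isClosed_univ
    (Filter.Eventually.of_forall fun _ => Set.mem_univ _) hp.integrable_id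
    (hp.integrable hconv.continuous_of_univ hK))

theorem Cicx_eq (hc : ∀ x, c ≤ θ x) (x : Fin d → ℝ) {p : ProbabilityMeasure (Fin d → ℝ)}
    (hp : Mom1 p) : Cicx θ x p = Theta θ (x - ∫ y, y ∂(p : Measure (Fin d → ℝ))) := by
  have hmem (m : Fin d → ℝ) (hm : m ≤ ∫ y, y ∂(p : Measure (Fin d → ℝ))) :
      Mom1 ⟨Measure.dirac m, inferInstance⟩ ∧ IcxLE ⟨Measure.dirac m, inferInstance⟩ p :=
    ⟨integrable_dirac (by simp), icxLE_dirac_of_le_mean hp hm⟩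
  have : Nonempty {q : ProbabilityMeasure (Fin d → ℝ) // Mom1 q ∧ IcxLE q p} :=
    ⟨⟨_, hmem _ le_rfl⟩⟩
  refine le_antisymm (le_Theta fun v hv => ?_) (le_ciInf fun q => ?_)
  · have := ciInf_le (bddBelow_range_of_le
      fun q : {q : ProbabilityMeasure (Fin d → ℝ) // Mom1 q ∧ IcxLE q p} =>
        hc (x - ∫ y, y ∂(q.1 : Measure (Fin d → ℝ)))) ⟨_, hmem _ (sub_le_self _ hv)⟩
    refine this.trans_eq ?_
    simp only [ProbabilityMeasure.coe_mk, integral_dirac]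
    congr 1
    abel
  · refine (Theta_le hc _ (sub_nonneg.2 (q.2.2.mean_le q.2.1 hp))).trans_eq ?_
    congr 1
    abel

end Theta

/-! ### The inf-convolution -/

/-- The inf-convolution of `φ` and `θ`. -/
def infConv (θ φ : (Fin d → ℝ) → ℝ) (x : Fin d → ℝ) : ℝ := ⨅ y, (φ y + θ (x - y))

section InfConv

variable {θ φ : (Fin d → ℝ) → ℝ}

theorem Rtheta_eq_iInf (hφ : Monotone φ) (x : Fin d → ℝ) :
    Rtheta θ φ x = ⨅ y, ((φ y + θ (x - y) : ℝ) : EReal) :=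
  le_antisymm (le_iInf fun y => iInf_le_of_le y (iInf₂_le y le_rfl))
    (le_iInf fun y => le_iInf₂ fun z hz => iInf_le_of_le y
      (EReal.coe_le_coe_iff.2 (by linarith [hφ hz])))

theorem Rtheta_eq_coe (hφ : Monotone φ) {x : Fin d → ℝ}
    (hb : BddBelow (Set.range fun y => φ y + θ (x - y))) :
    Rtheta θ φ x = (infConv θ φ x : EReal) := by
  rw [Rtheta_eq_iInf hφ, infConv, Monotone.map_ciInf_of_continuousAt
    continuous_coe_real_ereal.continuousAt EReal.coe_strictMono.monotone hb]

theorem Rtheta_eq_bot (hφ : Monotone φ) {x : Fin d → ℝ}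
    (hb : ¬ BddBelow (Set.range fun y => φ y + θ (x - y))) : Rtheta θ φ x = ⊥ := by
  rw [Rtheta_eq_iInf hφ, eq_bot_iff]
  refine EReal.le_of_forall_lt_iff_le.1 fun a _ => ?_
  rw [not_bddBelow_iff] at hb
  obtain ⟨_, ⟨y, rfl⟩, hy⟩ := hb a
  exact (iInf_le _ y).trans (EReal.coe_le_coe_iff.2 hy.le)

theorem convexOn_infConv_integrand (hφ : ConvexOn ℝ Set.univ φ) (hθ : ConvexOn ℝ Set.univ θ) :
    ConvexOn ℝ Set.univ
      fun z : (Fin d → ℝ) × (Fin d → ℝ) => φ z.2 + θ (z.1 - z.2) :=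
  (hφ.comp_linearMap (LinearMap.snd ℝ (Fin d → ℝ) (Fin d → ℝ))).add
    (hθ.comp_linearMap (LinearMap.fst ℝ (Fin d → ℝ) (Fin d → ℝ) - LinearMap.snd ℝ _ _))

theorem bddBelow_infConv_integrand (hφ : ConvexOn ℝ Set.univ φ) (hθ : ConvexOn ℝ Set.univ θ)
    {x₀ : Fin d → ℝ} (hb : BddBelow (Set.range fun y => φ y + θ (x₀ - y))) (x : Fin d → ℝ) :
    BddBelow (Set.range fun y => φ y + θ (x - y)) := by
  obtain ⟨m, hm⟩ := hb
  refine bddBelow_range_of_le (c := 2 * m - (φ 0 + θ ((2 : ℝ) • x₀ - x - 0))) fun y => ?_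
  have h := (convexOn_infConv_integrand hφ hθ).2 (Set.mem_univ (x, y))
    (Set.mem_univ ((2 : ℝ) • x₀ - x, 0)) (by norm_num : (0 : ℝ) ≤ 1 / 2)
    (by norm_num : (0 : ℝ) ≤ 1 / 2) (by norm_num)
  have e : (1 / 2 : ℝ) • x + (1 / 2 : ℝ) • ((2 : ℝ) • x₀ - x) = x₀ := by
    rw [smul_sub, smul_smul]
    norm_num
  have h' := hm ⟨(1 / 2 : ℝ) • y + (1 / 2 : ℝ) • 0, rfl⟩
  simp only [Prod.fst_add, Prod.smul_fst, Prod.snd_add, Prod.smul_snd, smul_eq_mul, e] at h h'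
  linarith

theorem infConv_le {x : Fin d → ℝ} (hb : BddBelow (Set.range fun y => φ y + θ (x - y)))
    (y : Fin d → ℝ) : infConv θ φ x ≤ φ y + θ (x - y) := ciInf_le hb y

theorem convexOn_infConv (hφ : ConvexOn ℝ Set.univ φ) (hθ : ConvexOn ℝ Set.univ θ)
    (hb : ∀ x, BddBelow (Set.range fun y => φ y + θ (x - y))) :
    ConvexOn ℝ Set.univ (infConv θ φ) := by
  refine (convexOn_iInf (F := fun x y => φ y + θ (x - y)) (convexOn_infConv_integrand hφ hθ)
    convex_univ Set.univ_nonempty fun x => ?_).congr fun x _ => ?_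
  · refine (hb x).mono ?_
    rintro _ ⟨y, rfl⟩
    exact ⟨y.1, rfl⟩
  · exact (Equiv.Set.univ (Fin d → ℝ)).iInf_congr fun _ => rfl

theorem monotone_infConv (hφ : Monotone φ)
    (hb : ∀ x, BddBelow (Set.range fun y => φ y + θ (x - y))) : Monotone (infConv θ φ) :=
  fun x x' hx => le_ciInf fun y => by
    have h := infConv_le (hb x) (y - (x' - x))
    have h2 : φ (y - (x' - x)) ≤ φ y := hφ (sub_le_self _ (sub_nonneg.2 hx))
    rw [show x - (y - (x' - x)) = x' - y by abel] at h
    linarith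

end InfConv

/-! ### Weak duality -/

theorem integrable_infConv {θ φ : (Fin d → ℝ) → ℝ} (hφ : ConvexOn ℝ Set.univ φ)
    (hθ : ConvexOn ℝ Set.univ θ) (hb : ∀ x, BddBelow (Set.range fun y => φ y + θ (x - y)))
    {p : ProbabilityMeasure (Fin d → ℝ)} (hp : Mom1 p)
    (hθp : Integrable θ (p : Measure (Fin d → ℝ))) :
    Integrable (infConv θ φ) (p : Measure (Fin d → ℝ)) := by
  have hr := convexOn_infConv hφ hθ hb
  obtain ⟨l, a, hl⟩ := exists_affine_minorant hr
  exact integrable_of_le_of_le hr.continuous_of_univ.aestronglyMeasurable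
    (Filter.Eventually.of_forall hl)
    (Filter.Eventually.of_forall fun x => by simpa using infConv_le (hb x) 0)
    (hp.integrable_affine l a) ((integrable_const (φ 0)).add hθp)

theorem dual_le_primal {θ φ : (Fin d → ℝ) → ℝ} {c : ℝ} (hc : ∀ x, c ≤ θ x)
    (hθ : ConvexOn ℝ Set.univ θ) (hφm : Monotone φ) (hφ : ConvexOn ℝ Set.univ φ)
    {μ ν μ' ν' : ProbabilityMeasure (Fin d → ℝ)}
    {π : ProbabilityMeasure ((Fin d → ℝ) × (Fin d → ℝ))}
    (hμ : Mom1 μ) (hν : Mom1 ν) (hμ' : Mom1 μ') (hν' : Mom1 ν')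
    (hθμ : Integrable θ (μ : Measure (Fin d → ℝ))) (hφν : Integrable φ (ν : Measure (Fin d → ℝ)))
    (hμμ' : IcxLE μ μ') (hνν' : IcxLE ν' ν) (hπ : IsCoupling μ' ν' π) :
    -((∫ y, φ y ∂(ν : Measure (Fin d → ℝ)) : ℝ) : EReal) +
        eIntE (μ : Measure (Fin d → ℝ)) (Rtheta θ φ) ≤
      eInt (π : Measure ((Fin d → ℝ) × (Fin d → ℝ))) (fun z => θ (z.1 - z.2)) := by
  by_cases hb0 : ∃ x, BddBelow (Set.range fun y => φ y + θ (x - y))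
  swap
  · push Not at hb0
    rw [show Rtheta θ φ = fun _ => ⊥ from funext fun x => Rtheta_eq_bot hφm (hb0 x), eIntE_bot, EReal.add_bot]
    exact bot_le
  obtain ⟨x₀, hx₀⟩ := hb0
  have hb := bddBelow_infConv_integrand hφ hθ hx₀
  have hr := convexOn_infConv hφ hθ hb
  by_cases hint : Integrable (fun z => θ (z.1 - z.2)) (π : Measure ((Fin d → ℝ) × (Fin d → ℝ)))
  swap
  · rw [eInt_eq_top (h := fun z : (Fin d → ℝ) × (Fin d → ℝ) => θ (z.1 - z.2)) (hθ.continuous_of_univ.comp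
      (continuous_fst.sub continuous_snd)).aestronglyMeasurable (fun z => hc _) hint]
    exact le_top
  rw [show Rtheta θ φ = fun x => (infConv θ φ x : EReal) from
      funext fun x => Rtheta_eq_coe hφm (hb x), eIntE_coe,
    eInt_eq_coe_integral (integrable_infConv hφ hθ hb hμ hθμ), eInt_eq_coe_integral hint,
    ← EReal.coe_neg, ← EReal.coe_add, EReal.coe_le_coe_iff]
  obtain ⟨hφν', hφle⟩ := hνν'.integrable_and_integral_le hν' hν hφm hφ hφν
  have hφπ : Integrable (fun z => φ z.2) (π : Measure ((Fin d → ℝ) × (Fin d → ℝ))) := by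
    rw [← hπ.2] at hφν'
    exact hφν'.comp_measurable measurable_snd
  have hφπ' : ∫ z, φ z.2 ∂(π : Measure ((Fin d → ℝ) × (Fin d → ℝ))) =
      ∫ y, φ y ∂(ν' : Measure (Fin d → ℝ)) := by
    rw [← hπ.2, integral_map measurable_snd.aemeasurable
      hφ.continuous_of_univ.aestronglyMeasurable]
  obtain ⟨l, a, hl⟩ := exists_affine_minorant hr
  have hle (z : (Fin d → ℝ) × (Fin d → ℝ)) : infConv θ φ z.1 ≤ φ z.2 + θ (z.1 - z.2) :=
    infConv_le (hb z.1) z.2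
  have hlπ : Integrable (fun z => l z.1 + a) (π : Measure ((Fin d → ℝ) × (Fin d → ℝ))) := by
    have := hμ'.integrable_affine l a
    rw [← hπ.1] at this
    exact this.comp_measurable measurable_fst
  have hrπ : Integrable (fun z => infConv θ φ z.1)
      (π : Measure ((Fin d → ℝ) × (Fin d → ℝ))) :=
    integrable_of_le_of_le (hr.continuous_of_univ.comp continuous_fst).aestronglyMeasurable
      (Filter.Eventually.of_forall fun z => hl z.1) (Filter.Eventually.of_forall hle) hlπ
      (hφπ.add hint)
  have hrπ' : ∫ z, infConv θ φ z.1 ∂(π : Measure ((Fin d → ℝ) × (Fin d → ℝ))) =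
      ∫ x, infConv θ φ x ∂(μ' : Measure (Fin d → ℝ)) := by
    rw [← hπ.1, integral_map measurable_fst.aemeasurable
      hr.continuous_of_univ.aestronglyMeasurable]
  have hrμ' : Integrable (infConv θ φ) (μ' : Measure (Fin d → ℝ)) := by
    rw [← hπ.1]
    exact (integrable_map_measure hr.continuous_of_univ.aestronglyMeasurable
      measurable_fst.aemeasurable).2 hrπ
  have h1 := (hμμ'.integrable_and_integral_le hμ hμ' (monotone_infConv hφm hb) hr hrμ').2
  have h2 := integral_mono hrπ (hφπ.add hint) hle
  simp only [Pi.add_apply] at h2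
  rw [integral_add hφπ hint] at h2
  linarith

/-! ### Barycenters of couplings -/

theorem norm_add_rpow_le {t : ℝ} (ht : 1 ≤ t) (x y : Fin d → ℝ) :
    ‖x + y‖ ^ t ≤ 2 ^ t * (‖x‖ ^ t + ‖y‖ ^ t) := by
  have ht0 : 0 ≤ t := zero_le_one.trans ht
  have h1 : ‖x + y‖ ≤ 2 * max ‖x‖ ‖y‖ := by
    linarith [norm_add_le x y, le_max_left ‖x‖ ‖y‖, le_max_right ‖x‖ ‖y‖]
  refine (Real.rpow_le_rpow (norm_nonneg _) h1 ht0).trans ?_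
  rw [Real.mul_rpow zero_le_two (le_max_of_le_left (norm_nonneg _))]
  refine mul_le_mul_of_nonneg_left ?_ (by positivity)
  have hx : 0 ≤ ‖x‖ ^ t := by positivity
  have hy : 0 ≤ ‖y‖ ^ t := by positivity
  rcases max_choice ‖x‖ ‖y‖ with h | h <;> rw [h] <;> linarith

theorem norm_sub_rpow_le {t : ℝ} (ht : 1 ≤ t) (x y : Fin d → ℝ) :
    ‖x - y‖ ^ t ≤ 2 ^ t * (‖x‖ ^ t + ‖y‖ ^ t) := by
  simpa [sub_eq_add_neg] using norm_add_rpow_le ht x (-y)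

theorem convexOn_norm_rpow {t : ℝ} (ht : 1 ≤ t) :
    ConvexOn ℝ Set.univ fun x : Fin d → ℝ => ‖x‖ ^ t := by
  have him : (norm '' (Set.univ : Set (Fin d → ℝ))) ⊆ Set.Ici 0 := by
    rintro _ ⟨x, -, rfl⟩
    exact norm_nonneg x
  refine ⟨convex_univ, fun x _ y _ a b ha hb hab => ?_⟩
  have h1 : ‖a • x + b • y‖ ≤ a * ‖x‖ + b * ‖y‖ :=
    (convexOn_norm convex_univ).2 (Set.mem_univ x) (Set.mem_univ y) ha hb hab
  exact (Real.rpow_le_rpow (norm_nonneg _) h1 (zero_le_one.trans ht)).trans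
    ((convexOn_rpow ht).2 (norm_nonneg x) (norm_nonneg y) ha hb hab)

/-- The barycenter of the conditional law of the second coordinate given the first one. -/
def bary (π : ProbabilityMeasure ((Fin d → ℝ) × (Fin d → ℝ))) (x : Fin d → ℝ) : Fin d → ℝ :=
  ∫ y, y ∂((π : Measure ((Fin d → ℝ) × (Fin d → ℝ))).condKernel x)

theorem measurable_bary (π : ProbabilityMeasure ((Fin d → ℝ) × (Fin d → ℝ))) :
    Measurable (bary π) :=
  (StronglyMeasurable.integral_kernel stronglyMeasurable_id).measurable

section Coupling

variable {μ ν : ProbabilityMeasure (Fin d → ℝ)}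
  {π : ProbabilityMeasure ((Fin d → ℝ) × (Fin d → ℝ))}

theorem IsCoupling.fst_eq (hπ : IsCoupling μ ν π) :
    (π : Measure ((Fin d → ℝ) × (Fin d → ℝ))).fst = (μ : Measure (Fin d → ℝ)) := hπ.1

theorem IsCoupling.integrable_snd (hπ : IsCoupling μ ν π) {G : Type*} [NormedAddCommGroup G]
    {f : (Fin d → ℝ) → G} (hf : Integrable f (ν : Measure (Fin d → ℝ))) :
    Integrable (fun z => f z.2) (π : Measure ((Fin d → ℝ) × (Fin d → ℝ))) := by
  rw [← hπ.2] at hf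
  exact hf.comp_measurable measurable_snd

theorem IsCoupling.ae_integrable (hπ : IsCoupling μ ν π) {G : Type*} [NormedAddCommGroup G]
    {f : (Fin d → ℝ) → G} (hf : Integrable f (ν : Measure (Fin d → ℝ))) :
    ∀ᵐ x ∂(μ : Measure (Fin d → ℝ)),
      Integrable f ((π : Measure ((Fin d → ℝ) × (Fin d → ℝ))).condKernel x) := by
  have := (hπ.integrable_snd hf).condKernel_ae
  rwa [hπ.fst_eq] at this

theorem IsCoupling.integrable_bary (hπ : IsCoupling μ ν π) (hν : Mom1 ν) :
    Integrable (bary π) (μ : Measure (Fin d → ℝ)) := by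
  have := (hπ.integrable_snd hν.integrable_id).integral_condKernel
  rwa [hπ.fst_eq] at this

theorem IsCoupling.integrable_comp_bary (hπ : IsCoupling μ ν π) (hν : Mom1 ν)
    {f : (Fin d → ℝ) → ℝ} (hf : ConvexOn ℝ Set.univ f)
    (hfν : Integrable f (ν : Measure (Fin d → ℝ))) :
    Integrable (fun x => f (bary π x)) (μ : Measure (Fin d → ℝ)) ∧
      ∫ x, f (bary π x) ∂(μ : Measure (Fin d → ℝ)) ≤ ∫ y, f y ∂(ν : Measure (Fin d → ℝ)) := by
  have hbary := hπ.integrable_bary hν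
  have hint := (hπ.integrable_snd hfν).integral_condKernel
  have hval := Measure.integral_condKernel (hπ.integrable_snd hfν)
  rw [hπ.fst_eq] at hint hval
  have hle : ∀ᵐ x ∂(μ : Measure (Fin d → ℝ)), f (bary π x) ≤
      ∫ y, f y ∂((π : Measure ((Fin d → ℝ) × (Fin d → ℝ))).condKernel x) := by
    filter_upwards [hπ.ae_integrable hν.integrable_id, hπ.ae_integrable hfν] with x h1 h2
    exact hf.map_integral_le hf.continuous_of_univ.continuousOn isClosed_univ
      (Filter.Eventually.of_forall fun _ => Set.mem_univ _) h1 h2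
  obtain ⟨l, a, hl⟩ := exists_affine_minorant hf
  have hfb : Integrable (fun x => f (bary π x)) (μ : Measure (Fin d → ℝ)) :=
    integrable_of_le_of_le
      (hf.continuous_of_univ.comp_aestronglyMeasurable hbary.1)
      (Filter.Eventually.of_forall fun x => hl _) hle
      ((l.integrable_comp hbary).add (integrable_const a)) hint
  refine ⟨hfb, (integral_mono_ae hfb hint hle).trans_eq (hval.trans ?_)⟩
  rw [← hπ.2, integral_map measurable_snd.aemeasurable
      hf.continuous_of_univ.aestronglyMeasurable]

theorem integrable_norm_sub_rpow {α : Type*} [MeasurableSpace α] {m : Measure α} {t : ℝ}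
    (ht : 1 ≤ t) {X Y : α → Fin d → ℝ} (hX : AEStronglyMeasurable X m)
    (hY : AEStronglyMeasurable Y m) (hXt : Integrable (fun a => ‖X a‖ ^ t) m)
    (hYt : Integrable (fun a => ‖Y a‖ ^ t) m) : Integrable (fun a => ‖X a - Y a‖ ^ t) m :=
  ((hXt.add hYt).const_mul (2 ^ t)).mono'
    (((convexOn_norm_rpow ht).continuous_of_univ.comp_aestronglyMeasurable (hX.sub hY)))
    (Filter.Eventually.of_forall fun a => by
      rw [Real.norm_of_nonneg (by positivity)]
      exact norm_sub_rpow_le ht _ _)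

theorem integrable_comp_of_growth {α : Type*} [MeasurableSpace α] {m : Measure α}
    [IsFiniteMeasure m] {t K : ℝ} {f : (Fin d → ℝ) → ℝ} (hf : Continuous f)
    (hK : ∀ x, |f x| ≤ K * (1 + ‖x‖ ^ t)) {X : α → Fin d → ℝ} (hX : AEStronglyMeasurable X m)
    (hXt : Integrable (fun a => ‖X a‖ ^ t) m) : Integrable (fun a => f (X a)) m :=
  (((integrable_const 1).add hXt).const_mul K).mono' (hf.comp_aestronglyMeasurable hX)
    (Filter.Eventually.of_forall fun a => by simpa using hK (X a))

theorem IsCoupling.integrable_theta_sub_bary (hπ : IsCoupling μ ν π) {t K : ℝ} (ht : 1 ≤ t)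
    (hμ : MomT t μ) (hν : MomT t ν) {θ : (Fin d → ℝ) → ℝ} (hθ : Continuous θ)
    (hK : ∀ x, |θ x| ≤ K * (1 + ‖x‖ ^ t)) :
    Integrable (fun x => θ (x - bary π x)) (μ : Measure (Fin d → ℝ)) :=
  integrable_comp_of_growth hθ hK
    (aestronglyMeasurable_id.sub (hπ.integrable_bary (hν.mom1 ht)).1)
    (integrable_norm_sub_rpow ht aestronglyMeasurable_id (hπ.integrable_bary (hν.mom1 ht)).1 hμ
      (hπ.integrable_comp_bary (hν.mom1 ht) (convexOn_norm_rpow ht) hν).1)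

theorem integrable_Theta_comp {α : Type*} [MeasurableSpace α] {m : Measure α}
    [IsFiniteMeasure m] {θ : (Fin d → ℝ) → ℝ} {c : ℝ} (hc : ∀ x, c ≤ θ x)
    (hθ : ConvexOn ℝ Set.univ θ) {X : α → Fin d → ℝ} (hX : AEStronglyMeasurable X m)
    (hint : Integrable (fun a => θ (X a)) m) : Integrable (fun a => Theta θ (X a)) m :=
  integrable_of_le_of_le ((convexOn_Theta hc hθ).continuous_of_univ.comp_aestronglyMeasurable hX)
    (Filter.Eventually.of_forall fun _ => le_Theta fun _ _ => hc _)
    (Filter.Eventually.of_forall fun _ => Theta_le_self hc _) (integrable_const c) hint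

theorem IsCoupling.eInt_Cicx (hπ : IsCoupling μ ν π) {t K c : ℝ} (ht : 1 ≤ t)
    (hμ : MomT t μ) (hν : MomT t ν) {θ : (Fin d → ℝ) → ℝ} (hc : ∀ x, c ≤ θ x)
    (hθ : ConvexOn ℝ Set.univ θ) (hK : ∀ x, |θ x| ≤ K * (1 + ‖x‖ ^ t)) :
    eInt (μ : Measure (Fin d → ℝ)) (fun x => Cicx θ x
        ⟨(π : Measure ((Fin d → ℝ) × (Fin d → ℝ))).condKernel x, inferInstance⟩) =
      ((∫ x, Theta θ (x - bary π x) ∂(μ : Measure (Fin d → ℝ)) : ℝ) : EReal) := by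
  refine Eq.trans (eInt_congr_ae ?_) (eInt_eq_coe_integral (integrable_Theta_comp hc hθ
    (X := fun x => x - bary π x)
    (aestronglyMeasurable_id.sub (hπ.integrable_bary (hν.mom1 ht)).1)
    (hπ.integrable_theta_sub_bary ht hμ hν hθ.continuous_of_univ hK)))
  filter_upwards [hπ.ae_integrable (hν.mom1 ht)] with x hx
  exact Cicx_eq hc x hx

end Coupling

/-! ### Measurable almost minimisers -/

/-- Running best choice among `w, w + v 0, w + v 1, …` for the cost `θ`. -/
def runningMin (θ : (Fin d → ℝ) → ℝ) (v : ℕ → Fin d → ℝ) : ℕ → (Fin d → ℝ) → Fin d → ℝ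
  | 0, w => w
  | n + 1, w => if θ (w + v n) < θ (runningMin θ v n w) then w + v n else runningMin θ v n w

section RunningMin

variable {θ : (Fin d → ℝ) → ℝ} {v : ℕ → Fin d → ℝ}

theorem measurable_runningMin (hθ : Measurable θ) (n : ℕ) : Measurable (runningMin θ v n) := by
  induction n with
  | zero => exact measurable_id
  | succ n ih =>
    exact Measurable.ite
      (measurableSet_lt (hθ.comp (measurable_id.add_const _)) (hθ.comp ih))
      (measurable_id.add_const _) ih

theorem le_runningMin (hv : ∀ n, 0 ≤ v n) (n : ℕ) (w : Fin d → ℝ) : w ≤ runningMin θ v n w := by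
  induction n with
  | zero => exact le_rfl
  | succ n ih =>
    simp only [runningMin]
    split_ifs
    · exact le_add_of_nonneg_right (hv n)
    · exact ih

theorem norm_runningMin_le (n : ℕ) (w : Fin d → ℝ) :
    ‖runningMin θ v n w‖ ≤ ‖w‖ + ∑ k ∈ Finset.range n, ‖v k‖ := by
  induction n with
  | zero => simp [runningMin]
  | succ n ih =>
    rw [Finset.sum_range_succ]
    simp only [runningMin]
    split_ifs
    · have : 0 ≤ ∑ k ∈ Finset.range n, ‖v k‖ := Finset.sum_nonneg fun _ _ => norm_nonneg _
      linarith [norm_add_le w (v n)]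
    · linarith [norm_nonneg (v n)]

theorem antitone_runningMin (w : Fin d → ℝ) : Antitone fun n => θ (runningMin θ v n w) :=
  antitone_nat_of_succ_le fun n => by
    simp only [runningMin]
    split_ifs with h
    · exact h.le
    · exact le_rfl

theorem runningMin_le_apply (w : Fin d → ℝ) (n : ℕ) :
    θ (runningMin θ v (n + 1) w) ≤ θ (w + v n) := by
  simp only [runningMin]
  split_ifs with h
  · exact le_rfl
  · exact not_lt.1 h

theorem tendsto_runningMin {c : ℝ} (hc : ∀ x, c ≤ θ x) (hθ : Continuous θ)
    (hv : ∀ n, 0 ≤ v n) (hdense : ∀ U : Set (Fin d → ℝ), IsOpen U → (∃ x ∈ U, 0 ≤ x) →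
      ∃ n, v n ∈ U) (w : Fin d → ℝ) :
    Filter.Tendsto (fun n => θ (runningMin θ v n w)) Filter.atTop (nhds (Theta θ w)) := by
  refine tendsto_order.2 ⟨fun a ha => Filter.Eventually.of_forall fun n => ha.trans_le ?_,
    fun a ha => ?_⟩
  · have := Theta_le hc w (sub_nonneg.2 (le_runningMin (θ := θ) hv n w))
    rwa [add_sub_cancel] at this
  · have : Nonempty {x : Fin d → ℝ // 0 ≤ x} := ⟨⟨0, le_rfl⟩⟩
    obtain ⟨⟨x, hx⟩, hxa⟩ := exists_lt_of_ciInf_lt ha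
    obtain ⟨n, hn⟩ := hdense {x | θ (w + x) < a}
      (isOpen_lt (hθ.comp (continuous_const.add continuous_id)) continuous_const) ⟨x, hxa, hx⟩
    filter_upwards [Filter.eventually_ge_atTop (n + 1)] with m hm
    exact ((antitone_runningMin w hm).trans (runningMin_le_apply w n)).trans_lt hn

end RunningMin

theorem exists_dense_nonneg (d : ℕ) : ∃ v : ℕ → Fin d → ℝ, (∀ n, 0 ≤ v n) ∧
    ∀ U : Set (Fin d → ℝ), IsOpen U → (∃ x ∈ U, 0 ≤ x) → ∃ n, v n ∈ U := by
  have : Nonempty {x : Fin d → ℝ // 0 ≤ x} := ⟨⟨0, le_rfl⟩⟩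
  refine ⟨fun n => (TopologicalSpace.denseSeq {x : Fin d → ℝ // 0 ≤ x} n).1,
    fun n => (TopologicalSpace.denseSeq {x : Fin d → ℝ // 0 ≤ x} n).2, fun U hU ⟨x, hxU, hx⟩ => ?_⟩
  obtain ⟨n, hn⟩ := (TopologicalSpace.denseRange_denseSeq {x : Fin d → ℝ // 0 ≤ x}).exists_mem_open
    (hU.preimage continuous_subtype_val) ⟨⟨x, hx⟩, hxU⟩
  exact ⟨n, hn⟩

/-! ### From weak transport to a relaxed second marginal -/

theorem IsCoupling.exists_relaxed {μ ν : ProbabilityMeasure (Fin d → ℝ)}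
    {π : ProbabilityMeasure ((Fin d → ℝ) × (Fin d → ℝ))} (hπ : IsCoupling μ ν π)
    (hν : Mom1 ν) {m : (Fin d → ℝ) → Fin d → ℝ} (hm : Measurable m)
    (hmint : Integrable m (μ : Measure (Fin d → ℝ))) (hmb : ∀ x, m x ≤ bary π x) :
    ∃ ν' : ProbabilityMeasure (Fin d → ℝ), Mom1 ν' ∧ IcxLE ν' ν ∧
      ∃ π' : ProbabilityMeasure ((Fin d → ℝ) × (Fin d → ℝ)), IsCoupling μ ν' π' ∧
        ∀ θ : (Fin d → ℝ) → ℝ, Continuous θ →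
          Integrable (fun x => θ (x - m x)) (μ : Measure (Fin d → ℝ)) →
          eInt (π' : Measure ((Fin d → ℝ) × (Fin d → ℝ))) (fun z => θ (z.1 - z.2)) =
            ((∫ x, θ (x - m x) ∂(μ : Measure (Fin d → ℝ)) : ℝ) : EReal) := by
  have hpair : Measurable fun x => (x, m x) := measurable_id.prodMk hm
  refine ⟨⟨(μ : Measure (Fin d → ℝ)).map m, Measure.isProbabilityMeasure_map hm.aemeasurable⟩,
    ?_, ?_, ⟨(μ : Measure (Fin d → ℝ)).map fun x => (x, m x),
      Measure.isProbabilityMeasure_map hpair.aemeasurable⟩, ⟨?_, ?_⟩, ?_⟩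
  · exact (integrable_map_measure continuous_norm.aestronglyMeasurable hm.aemeasurable).2
      hmint.norm
  · rintro f hf hconv ⟨K, hK⟩
    have hfν := hν.integrable hconv.continuous_of_univ hK
    obtain ⟨h1, h2⟩ := hπ.integrable_comp_bary hν hconv hfν
    rw [ProbabilityMeasure.coe_mk, integral_map hm.aemeasurable
      hconv.continuous_of_univ.aestronglyMeasurable]
    have hfm : Integrable (fun x => f (m x)) (μ : Measure (Fin d → ℝ)) :=
      (((integrable_const 1).add hmint.norm).const_mul K).mono'
        (hconv.continuous_of_univ.measurable.comp hm).aestronglyMeasurable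
        (Filter.Eventually.of_forall fun x => by simpa using hK (m x))
    exact (integral_mono hfm h1 fun x => hf (hmb x)).trans h2
  · rw [ProbabilityMeasure.coe_mk, Measure.map_map measurable_fst hpair]
    exact Measure.map_id
  · rw [ProbabilityMeasure.coe_mk, Measure.map_map measurable_snd hpair]
    rfl
  · intro θ hθ hint
    have hmeas : AEStronglyMeasurable (fun z : (Fin d → ℝ) × (Fin d → ℝ) => θ (z.1 - z.2))
        ((μ : Measure (Fin d → ℝ)).map fun x => (x, m x)) :=
      (hθ.comp (continuous_fst.sub continuous_snd)).aestronglyMeasurable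
    rw [ProbabilityMeasure.coe_mk, eInt_eq_coe_integral
      ((integrable_map_measure hmeas hpair.aemeasurable).2 hint),
      integral_map hpair.aemeasurable hmeas]

theorem relaxed_le_weak {μ ν : ProbabilityMeasure (Fin d → ℝ)}
    {π : ProbabilityMeasure ((Fin d → ℝ) × (Fin d → ℝ))} (hπ : IsCoupling μ ν π)
    {t K c : ℝ} (ht : 1 ≤ t) (hμ : MomT t μ) (hν : MomT t ν) {θ : (Fin d → ℝ) → ℝ}
    (hc : ∀ x, c ≤ θ x) (hθ : ConvexOn ℝ Set.univ θ) (hK : ∀ x, |θ x| ≤ K * (1 + ‖x‖ ^ t)) :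
    (⨅ (ν' : ProbabilityMeasure (Fin d → ℝ)) (_ : Mom1 ν') (_ : IcxLE ν' ν)
          (π : ProbabilityMeasure ((Fin d → ℝ) × (Fin d → ℝ))) (_ : IsCoupling μ ν' π),
        eInt (π : Measure ((Fin d → ℝ) × (Fin d → ℝ))) (fun z => θ (z.1 - z.2))) ≤
      ((∫ x, Theta θ (x - bary π x) ∂(μ : Measure (Fin d → ℝ)) : ℝ) : EReal) := by
  obtain ⟨v, hv, hdense⟩ := exists_dense_nonneg d
  have hθc := hθ.continuous_of_univ
  have hμ1 := hμ.mom1 ht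
  have hν1 := hν.mom1 ht
  have hb := measurable_bary π
  have hbint := hπ.integrable_bary hν1
  have hθb := hπ.integrable_theta_sub_bary ht hμ hν hθc hK
  set u := runningMin θ v
  have hu (n) : Measurable fun x => u n (x - bary π x) :=
    (measurable_runningMin hθc.measurable n).comp (measurable_id.sub hb)
  have huint (n) : Integrable (fun x => u n (x - bary π x)) (μ : Measure (Fin d → ℝ)) :=
    ((hμ1.integrable_id.sub hbint).norm.add (integrable_const _)).mono'
      (hu n).aestronglyMeasurable
      (Filter.Eventually.of_forall fun x => norm_runningMin_le n _)
  have hθu_le (n x) : θ (u n (x - bary π x)) ≤ θ (x - bary π x) :=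
    antitone_runningMin _ (Nat.zero_le n)
  have hθu (n) : Integrable (fun x => θ (u n (x - bary π x))) (μ : Measure (Fin d → ℝ)) :=
    integrable_of_le_of_le (hθc.measurable.comp (hu n)).aestronglyMeasurable
      (Filter.Eventually.of_forall fun x => hc _)
      (Filter.Eventually.of_forall (hθu_le n)) (integrable_const c) hθb
  have hlim : Filter.Tendsto
      (fun n => ∫ x, θ (u n (x - bary π x)) ∂(μ : Measure (Fin d → ℝ))) Filter.atTop
      (nhds (∫ x, Theta θ (x - bary π x) ∂(μ : Measure (Fin d → ℝ)))) :=
    integral_tendsto_of_tendsto_of_antitone hθu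
      (integrable_Theta_comp hc hθ (measurable_id.sub hb).aestronglyMeasurable hθb)
      (Filter.Eventually.of_forall fun x => antitone_runningMin _)
      (Filter.Eventually.of_forall fun x => tendsto_runningMin hc hθc hv hdense _)
  refine ge_of_tendsto' ((continuous_coe_real_ereal.tendsto _).comp hlim) fun n => ?_
  obtain ⟨ν', h1, h2, π', h3, h4⟩ := hπ.exists_relaxed hν1
    (m := fun x => x - u n (x - bary π x)) (measurable_id.sub (hu n))
    (hμ1.integrable_id.sub (huint n)) fun x => by
      rw [sub_le_comm]
      exact le_runningMin hv n _
  refine iInf_le_of_le ν' (iInf₂_le_of_le h1 h2 (iInf₂_le_of_le π' h3 ?_))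
  exact (h4 θ hθc (by simpa using hθu n)).le.trans_eq (congrArg Real.toEReal
    (integral_congr_ae (Filter.Eventually.of_forall fun x => by simp)))

/-! ### Maxima of finitely many affine functions -/

/-- The maximum of finitely many affine functions. -/
def maxAffine {ι : Type*} (a : ι → ℝ) (l : ι → (Fin d → ℝ) →L[ℝ] ℝ) (y : Fin d → ℝ) : ℝ :=
  ⨆ i, (a i + l i y)

section MaxAffine

variable {ι : Type*} [Fintype ι] (a : ι → ℝ) (l : ι → (Fin d → ℝ) →L[ℝ] ℝ)

theorem le_maxAffine (i : ι) (y : Fin d → ℝ) : a i + l i y ≤ maxAffine a l y :=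
  le_ciSup (f := fun i => a i + l i y) (Finite.bddAbove_range _) i

theorem maxAffine_mono (hl : ∀ i v, 0 ≤ v → 0 ≤ l i v) : Monotone (maxAffine a l) :=
  fun _ _ hxy => ciSup_mono (Finite.bddAbove_range _) fun i =>
    add_le_add_right (ContinuousLinearMap.monotone_of_nonneg (hl i) hxy) _

variable [Nonempty ι]

theorem convexOn_maxAffine : ConvexOn ℝ Set.univ (maxAffine a l) := by
  refine ⟨convex_univ, fun x _ y _ s r hs hr hsr => ciSup_le fun i => ?_⟩
  have h1 := mul_le_mul_of_nonneg_left (le_maxAffine a l i x) hs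
  have h2 := mul_le_mul_of_nonneg_left (le_maxAffine a l i y) hr
  have h3 : a i = s * a i + r * a i := by rw [← add_mul, hsr, one_mul]
  simp only [map_add, map_smul, smul_eq_mul]
  linarith

theorem abs_maxAffine_le (y : Fin d → ℝ) :
    |maxAffine a l y| ≤ (∑ i, (‖l i‖ + |a i|)) * (1 + ‖y‖) := by
  obtain ⟨i, hi⟩ := exists_eq_ciSup_of_finite (f := fun i => a i + l i y)
  rw [maxAffine, ← hi, add_comm]
  refine (abs_affine_le _ _ _).trans (mul_le_mul_of_nonneg_right ?_ (by positivity))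
  exact Finset.single_le_sum (f := fun i => ‖l i‖ + |a i|) (fun j _ => by positivity)
    (Finset.mem_univ i)

end MaxAffine

/-! ### Partitions of unity -/

/-- A measurable partition of unity indexed by `ι`. -/
structure IsWeightFamily {ι : Type*} [Fintype ι] (g : ι → (Fin d → ℝ) → ℝ) : Prop where
  measurable : ∀ i, Measurable (g i)
  nonneg : ∀ i y, 0 ≤ g i y
  sum_eq_one : ∀ y, ∑ i, g i y = 1

namespace IsWeightFamily

variable {ι : Type*} [Fintype ι] {g h : ι → (Fin d → ℝ) → ℝ}
  {ν : Measure (Fin d → ℝ)}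

theorem le_one (hg : IsWeightFamily g) (i : ι) (y : Fin d → ℝ) : g i y ≤ 1 :=
  (Finset.single_le_sum (f := fun i => g i y) (fun j _ => hg.nonneg j y)
    (Finset.mem_univ i)).trans_eq (hg.sum_eq_one y)

theorem integrable_smul (hg : IsWeightFamily g) (hν : Integrable (fun y => y) ν) (i : ι) :
    Integrable (fun y => g i y • y) ν :=
  hν.mono ((hg.measurable i).smul measurable_id).aestronglyMeasurable
    (Filter.Eventually.of_forall fun y => by
      rw [norm_smul, Real.norm_of_nonneg (hg.nonneg i y)]
      exact mul_le_of_le_one_left (norm_nonneg y) (hg.le_one i y))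

theorem integral_nonneg (hg : IsWeightFamily g) (i : ι) : 0 ≤ ∫ y, g i y ∂ν :=
  MeasureTheory.integral_nonneg (hg.nonneg i)

theorem combo (hg : IsWeightFamily g) (hh : IsWeightFamily h) {s r : ℝ} (hs : 0 ≤ s) (hr : 0 ≤ r)
    (hsr : s + r = 1) : IsWeightFamily fun i y => s * g i y + r * h i y where
  measurable i := ((hg.measurable i).const_mul s).add ((hh.measurable i).const_mul r)
  nonneg i y := add_nonneg (mul_nonneg hs (hg.nonneg i y)) (mul_nonneg hr (hh.nonneg i y))
  sum_eq_one y := by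
    rw [Finset.sum_add_distrib, ← Finset.mul_sum, ← Finset.mul_sum, hg.sum_eq_one,
      hh.sum_eq_one, mul_one, mul_one, hsr]

theorem integral_combo_smul (hg : IsWeightFamily g) (hh : IsWeightFamily h)
    (hν : Integrable (fun y => y) ν) (s r : ℝ) (i : ι) :
    ∫ y, (s * g i y + r * h i y) • y ∂ν =
      s • ∫ y, g i y • y ∂ν + r • ∫ y, h i y • y ∂ν := by
  simp only [add_smul, mul_smul]
  rw [integral_add (f := fun y => s • g i y • y) (g := fun y => r • h i y • y)
    ((hg.integrable_smul hν i).smul s) ((hh.integrable_smul hν i).smul r), integral_smul,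
    integral_smul]

variable [IsProbabilityMeasure ν]

theorem integrable (hg : IsWeightFamily g) (i : ι) : Integrable (g i) ν :=
  (integrable_const (1 : ℝ)).mono' (hg.measurable i).aestronglyMeasurable
    (Filter.Eventually.of_forall fun y => by
      rw [Real.norm_of_nonneg (hg.nonneg i y)]; exact hg.le_one i y)

theorem sum_integral (hg : IsWeightFamily g) : ∑ i, ∫ y, g i y ∂ν = 1 := by
  rw [← integral_finsetSum _ fun i _ => hg.integrable i]
  simp [hg.sum_eq_one]

theorem const {ρ : ι → ℝ} (h0 : ∀ i, 0 ≤ ρ i) (h1 : ∑ i, ρ i = 1) :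
    IsWeightFamily fun i (_ : Fin d → ℝ) => ρ i :=
  ⟨fun _ => measurable_const, fun i _ => h0 i, fun _ => h1⟩

theorem integral_combo (hg : IsWeightFamily g) (hh : IsWeightFamily h) (s r : ℝ) (i : ι) :
    ∫ y, (s * g i y + r * h i y) ∂ν = s * ∫ y, g i y ∂ν + r * ∫ y, h i y ∂ν := by
  rw [integral_add ((hg.integrable i).const_mul s) ((hh.integrable i).const_mul r),
    integral_const_mul, integral_const_mul]

/-- Some partition of unity is concentrated on the maximisers of given affine functions. -/
theorem exists_maximiser [Nonempty ι] (a : ι → ℝ) (l : ι → (Fin d → ℝ) →L[ℝ] ℝ) :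
    ∃ g : ι → (Fin d → ℝ) → ℝ, IsWeightFamily g ∧
      ∀ y, ∑ i, g i y * (a i + l i y) = maxAffine a l y := by
  classical
  have hcont := (convexOn_maxAffine a l).continuous_of_univ
  have hset (i) : MeasurableSet {y | a i + l i y = maxAffine a l y} :=
    measurableSet_eq_fun ((l i).continuous.measurable.const_add _) hcont.measurable
  set e : ι → (Fin d → ℝ) → ℝ := fun i y => if a i + l i y = maxAffine a l y then 1 else 0
  have he (i) : Measurable (e i) := Measurable.ite (hset i) measurable_const measurable_const
  have he0 (i y) : 0 ≤ e i y := by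
    simp only [e]
    split_ifs <;> norm_num
  have hpos (y) : 0 < ∑ i, e i y := by
    obtain ⟨i, hi⟩ := exists_eq_ciSup_of_finite (f := fun i => a i + l i y)
    refine Finset.sum_pos' (fun i _ => he0 i y) ⟨i, Finset.mem_univ i, ?_⟩
    simp only [e]
    rw [if_pos (show a i + l i y = maxAffine a l y from hi)]
    exact one_pos
  refine ⟨fun i y => e i y / ∑ j, e j y,
    ⟨fun i => (he i).div (Finset.measurable_sum _ fun j _ => he j),
      fun i y => div_nonneg (he0 i y) (hpos y).le, fun y => ?_⟩, fun y => ?_⟩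
  · rw [← Finset.sum_div, div_self (hpos y).ne']
  · have hmul (i) : (e i y / ∑ j, e j y) * (a i + l i y) =
        (e i y / ∑ j, e j y) * maxAffine a l y := by
      simp only [e]
      split_ifs with h
      · rw [h]
      · simp
    rw [Finset.sum_congr rfl fun i _ => hmul i, ← Finset.sum_mul, ← Finset.sum_div,
      div_self (hpos y).ne', one_mul]

end IsWeightFamily

/-! ### Finite-dimensional duality -/

section FiniteDuality

variable {ι : Type*} [Fintype ι] {ν : Measure (Fin d → ℝ)} [IsProbabilityMeasure ν]
  {m : ι → ℝ} {J : (ι → Fin d → ℝ) → ℝ}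

/-- Masses that deviate slightly from `m` can be corrected at a small cost. -/
theorem le_of_approximate_masses [Nonempty ι] (hν : Integrable (fun y => y) ν)
    (hm : ∀ i, 0 < m i) (hm1 : ∑ i, m i = 1) (hJ : ConvexOn ℝ Set.univ J) (hJc : Continuous J)
    {V ε : ℝ} (hε : 0 < ε)
    (hV : ∀ g : ι → (Fin d → ℝ) → ℝ, IsWeightFamily g → (∀ i, ∫ y, g i y ∂ν = m i) →
      V ≤ J fun i => ∫ y, g i y • y ∂ν) :
    ∃ η > 0, ∀ g : ι → (Fin d → ℝ) → ℝ, IsWeightFamily g →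
      (∀ i, |∫ y, g i y ∂ν - m i| < η) → V - ε ≤ J fun i => ∫ y, g i y • y ∂ν := by
  obtain ⟨C, hC⟩ := (isCompact_stdSimplex ℝ ι).bddAbove_image
    (f := fun ρ : ι → ℝ => J fun i => ρ i • ∫ y, y ∂ν)
    (hJc.comp (continuous_pi fun i => (continuous_apply i).smul continuous_const)).continuousOn
  obtain ⟨i₀, hi₀⟩ := Finite.exists_min m
  set D := C - V + ε with hD
  have hden : 0 < |D| + 1 + ε := by positivity
  set κ := ε / (|D| + 1 + ε) with hκ
  have hκ0 : 0 < κ := div_pos hε hden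
  have hκ1 : κ < 1 := (div_lt_one hden).2 (by linarith [abs_nonneg D])
  have hκD : κ * D < ε := by
    have h1 : κ * (|D| + 1 + ε) = ε := div_mul_cancel₀ _ hden.ne'
    nlinarith [mul_le_mul_of_nonneg_left (le_abs_self D) hκ0.le, mul_pos hκ0 hε]
  refine ⟨κ * m i₀, mul_pos hκ0 (hm i₀), fun g hg hgm => ?_⟩
  by_contra! hlt
  set M : ι → ℝ := fun i => ∫ y, g i y ∂ν
  set ρ : ι → ℝ := fun i => (m i - (1 - κ) * M i) / κ with hρ
  have hρ0 (i) : 0 ≤ ρ i := by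
    refine div_nonneg ?_ hκ0.le
    have h1 : M i < m i + κ * m i := by
      have := (abs_lt.1 (hgm i)).2
      have := mul_le_mul_of_nonneg_left (hi₀ i) hκ0.le
      simp only [M]
      linarith
    nlinarith [mul_le_mul_of_nonneg_left h1.le (sub_nonneg.2 hκ1.le),
      mul_nonneg (mul_pos hκ0 hκ0).le (hm i).le]
  have hρ1 : ∑ i, ρ i = 1 := by
    rw [hρ, ← Finset.sum_div, Finset.sum_sub_distrib, ← Finset.mul_sum, hm1, hg.sum_integral,
      div_eq_one_iff_eq hκ0.ne']
    ring
  have hρw : IsWeightFamily fun i (_ : Fin d → ℝ) => ρ i := .const hρ0 hρ1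
  have hw := hg.combo hρw (sub_nonneg.2 hκ1.le) hκ0.le (by ring)
  have h1 := hV _ hw fun i => by
    rw [hg.integral_combo hρw]
    simp only [integral_const, probReal_univ, one_smul, hρ, M]
    field_simp
    ring
  have h2 : (fun i => ∫ y, ((1 - κ) * g i y + κ * ρ i) • y ∂ν) =
      (1 - κ) • (fun i => ∫ y, g i y • y ∂ν) + κ • fun i => ρ i • ∫ y, y ∂ν := by
    funext i
    rw [hg.integral_combo_smul hρw hν, integral_smul]
    rfl
  rw [h2] at h1
  have h3 := hJ.2 (Set.mem_univ fun i => ∫ y, g i y • y ∂ν)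
    (Set.mem_univ fun i => ρ i • ∫ y, y ∂ν) (sub_nonneg.2 hκ1.le) hκ0.le (by ring)
  have h4 : J (fun i => ρ i • ∫ y, y ∂ν) ≤ C := hC ⟨ρ, ⟨hρ0, hρ1⟩, rfl⟩
  simp only [smul_eq_mul] at h3
  nlinarith [mul_le_mul_of_nonneg_left hlt.le (sub_nonneg.2 hκ1.le),
    mul_le_mul_of_nonneg_left h4 hκ0.le]

theorem exists_functional_decomposition [DecidableEq ι]
    (f : ((ι → ℝ) × (ι → Fin d → ℝ) × ℝ) →L[ℝ] ℝ) :
    ∃ (α : ι → ℝ) (L : ι → (Fin d → ℝ) →L[ℝ] ℝ) (σ : ℝ), ∀ M B s,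
      f (M, B, s) = ∑ i, (M i * α i + L i (B i)) + s * σ := by
  refine ⟨fun i => f (Pi.single i 1, 0, 0), fun i => f ∘SL ContinuousLinearMap.inr ℝ _ _ ∘SL
    ContinuousLinearMap.inl ℝ _ _ ∘SL ContinuousLinearMap.single ℝ (fun _ : ι => Fin d → ℝ) i,
    f (0, 0, 1), fun M B s => ?_⟩
  have h1 : (M, B, s) = ∑ i, (M i • ((Pi.single i 1, 0, 0) : (ι → ℝ) × (ι → Fin d → ℝ) × ℝ) +
      (0, Pi.single i (B i), 0)) + s • (0, 0, 1) := by
    have e1 : ∑ i, M i • (Pi.single i 1 : ι → ℝ) = M := by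
      simpa [← Pi.single_smul] using Finset.univ_sum_single M
    have e2 := Finset.univ_sum_single B
    refine Prod.ext ?_ (Prod.ext ?_ ?_) <;> simp [Prod.fst_sum, Prod.snd_sum, e1, e2]
  rw [h1]
  simp only [map_add, map_sum, map_smul, smul_eq_mul]
  rfl

/-- A Hahn–Banach multiplier for the finite-dimensional transport problem. -/
theorem exists_multiplier [Nonempty ι] (hν : Integrable (fun y => y) ν)
    (hm : ∀ i, 0 < m i) (hm1 : ∑ i, m i = 1) (hJ : ConvexOn ℝ Set.univ J) (hJc : Continuous J)
    (hJa : Antitone J) {V ε : ℝ} (hε : 0 < ε)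
    (hV : ∀ g : ι → (Fin d → ℝ) → ℝ, IsWeightFamily g → (∀ i, ∫ y, g i y ∂ν = m i) →
      V ≤ J fun i => ∫ y, g i y • y ∂ν) :
    ∃ (a : ι → ℝ) (l : ι → (Fin d → ℝ) →L[ℝ] ℝ), (∀ i v, 0 ≤ v → 0 ≤ l i v) ∧
      ∀ B, V - ε ≤ J B + ∑ i, (m i * a i + l i (B i)) - ∫ y, maxAffine a l y ∂ν := by
  classical
  obtain ⟨η, hη, hη'⟩ := le_of_approximate_masses hν hm hm1 hJ hJc hε hV
  set O : Set ((ι → ℝ) × (ι → Fin d → ℝ) × ℝ) :=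
    {z | z.1 ∈ Metric.ball m η ∧ J z.2.1 + z.2.2 < V - ε} with hO
  set A : Set ((ι → ℝ) × (ι → Fin d → ℝ) × ℝ) :=
    {z | ∃ g : ι → (Fin d → ℝ) → ℝ, IsWeightFamily g ∧ z.1 = (fun i => ∫ y, g i y ∂ν) ∧
      z.2.1 = (fun i => ∫ y, g i y • y ∂ν) ∧ 0 ≤ z.2.2} with hA
  have hOo : IsOpen O := (Metric.isOpen_ball.preimage continuous_fst).inter
    (isOpen_lt ((hJc.comp (continuous_fst.comp continuous_snd)).add
      (continuous_snd.comp continuous_snd)) continuous_const)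
  have hOc : Convex ℝ O := by
    rintro ⟨M, B, s⟩ ⟨h1, h2⟩ ⟨M', B', s'⟩ ⟨h1', h2'⟩ p q hp hq hpq
    refine ⟨convex_ball m η h1 h1' hp hq hpq, ?_⟩
    have h3 := hJ.2 (Set.mem_univ B) (Set.mem_univ B') hp hq hpq
    have h4 := (convex_Iio (𝕜 := ℝ) (V - ε)) h2 h2' hp hq hpq
    simp only [smul_eq_mul, Set.mem_Iio] at h3 h4
    simp only [Prod.smul_mk, Prod.mk_add_mk, smul_eq_mul]
    linarith
  have hAc : Convex ℝ A := by
    rintro ⟨M, B, s⟩ ⟨g, hg, h1, h2, h3⟩ ⟨M', B', s'⟩ ⟨g', hg', h1', h2', h3'⟩ p q hp hq hpq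
    refine ⟨_, hg.combo hg' hp hq hpq, ?_, ?_,
      add_nonneg (mul_nonneg hp h3) (mul_nonneg hq h3')⟩
    · funext i
      rw [hg.integral_combo hg']
      simp only at h1 h1'
      simp [h1, h1']
    · funext i
      rw [hg.integral_combo_smul hg' hν]
      simp only at h2 h2'
      simp [h2, h2']
  have hdisj : Disjoint O A := by
    rw [Set.disjoint_left]
    rintro ⟨M, B, s⟩ ⟨h1, h2⟩ ⟨g, hg, h3, h4, h5⟩
    simp only at h1 h2 h3 h4 h5
    subst h3 h4
    have := hη' g hg fun i => by
      rw [← Real.dist_eq]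
      exact (dist_le_pi_dist (fun i => ∫ y, g i y ∂ν) m i).trans_lt h1
    linarith
  obtain ⟨f, u, hfO, hfA⟩ := geometric_hahn_banach_open hOc hOo hAc hdisj
  obtain ⟨α, L, σ, hf⟩ := exists_functional_decomposition f
  have hO' (B s) (h : J B + s < V - ε) : ∑ i, (m i * α i + L i (B i)) + s * σ < u := by
    rw [← hf]
    exact hfO _ ⟨Metric.mem_ball_self hη, h⟩
  have hA' (g) (hg : IsWeightFamily g) : u ≤ ∫ y, ∑ i, g i y * (α i + L i y) ∂ν := by
    refine (hfA (fun i => ∫ y, g i y ∂ν, fun i => ∫ y, g i y • y ∂ν, 0)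
      ⟨g, hg, rfl, rfl, le_rfl⟩).trans_eq ?_
    have hint (i) : Integrable (fun y => L i (g i y • y)) ν :=
      (L i).integrable_comp (hg.integrable_smul hν i)
    have e (i) : (∫ y, g i y ∂ν) * α i + L i (∫ y, g i y • y ∂ν) =
        ∫ y, g i y * (α i + L i y) ∂ν := by
      rw [← ContinuousLinearMap.integral_comp_comm _ (hg.integrable_smul hν i),
        ← integral_mul_const, ← integral_add ((hg.integrable i).mul_const _) (hint i)]
      simp only [map_smul, smul_eq_mul, mul_add]
    rw [hf, zero_mul, add_zero, Finset.sum_congr rfl fun i _ => e i, integral_finsetSum]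
    intro i _
    refine (((hg.integrable i).mul_const (α i)).add (hint i)).congr
      (Filter.Eventually.of_forall fun y => ?_)
    simp [mul_add]
  have hσ : 0 < σ := by
    have hg : IsWeightFamily fun i (_ : Fin d → ℝ) => m i := .const (fun i => (hm i).le) hm1
    set B : ι → Fin d → ℝ := fun i => ∫ y, m i • y ∂ν
    set s := min (-1) (V - ε - J B - 1)
    have h1 := hO' B s (by linarith [min_le_right (-1) (V - ε - J B - 1)])
    have h2 := hfA (m, B, 0) ⟨_, hg, by simp, rfl, le_rfl⟩
    rw [hf] at h2
    have hs : s < 0 := (min_le_left _ _).trans_lt (by norm_num)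
    by_contra! hσ
    nlinarith [mul_nonneg_of_nonpos_of_nonpos hs.le hσ]
  set a : ι → ℝ := fun i => -α i / σ
  set l : ι → (Fin d → ℝ) →L[ℝ] ℝ := fun i => (-σ⁻¹) • L i
  have hal (i y) : α i + L i y = -σ * (a i + l i y) := by
    simp only [a, l, _root_.smul_apply, smul_eq_mul]
    field_simp
    ring
  have hmax : u ≤ -σ * ∫ y, maxAffine a l y ∂ν := by
    obtain ⟨g, hg, hg'⟩ := IsWeightFamily.exists_maximiser a l
    refine (hA' g hg).trans_eq ?_
    rw [← integral_const_mul]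
    congr 1
    funext y
    rw [← hg', Finset.mul_sum]
    exact Finset.sum_congr rfl fun i _ => by rw [hal]; ring
  have hmain (B) : V - ε ≤ J B + ∑ i, (m i * a i + l i (B i)) - ∫ y, maxAffine a l y ∂ν := by
    have h1 : ∑ i, (m i * α i + L i (B i)) = -σ * ∑ i, (m i * a i + l i (B i)) := by
      rw [Finset.mul_sum]
      refine Finset.sum_congr rfl fun i _ => ?_
      simp only [a, l, _root_.smul_apply, smul_eq_mul]
      field_simp
      ring
    refine le_of_forall_pos_le_add fun δ hδ => ?_
    have h2 := (hO' B (V - ε - J B - δ) (by linarith)).trans_le hmax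
    rw [h1] at h2
    have h3 : σ * (V - ε - J B - δ - ∑ i, (m i * a i + l i (B i)) + ∫ y, maxAffine a l y ∂ν)
      < σ * 0 := by linarith
    have := lt_of_mul_lt_mul_left h3 hσ.le
    linarith
  refine ⟨a, l, fun i v hv => ?_, hmain⟩
  refine nonneg_of_forall_le_add_mul (a := V - ε)
    (b := J 0 + ∑ i, m i * a i - ∫ y, maxAffine a l y ∂ν) fun s hs => ?_
  have h1 := hmain (Pi.single i (s • v))
  have h2 : J (Pi.single i (s • v)) ≤ J 0 := hJa (Pi.single_nonneg.2 (smul_nonneg hs hv))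
  have h3 : ∑ j, l j (Pi.single (M := fun _ => Fin d → ℝ) i (s • v) j) = s * l i v := by
    rw [Finset.sum_eq_single i]
    · simp
    · intro j _ hj
      rw [Pi.single_eq_of_ne hj, map_zero]
    · simp
  rw [Finset.sum_add_distrib, h3] at h1
  linarith

end FiniteDuality

/-! ### Cells of a finite partition -/

section Cells

variable {ι : Type*} [Fintype ι] [MeasurableSpace ι] [MeasurableSingletonClass ι]
  {μ : Measure (Fin d → ℝ)} {c : (Fin d → ℝ) → ι}

/-- The mean of `μ` over the cell `c = i`. -/
def cellMean (μ : Measure (Fin d → ℝ)) (c : (Fin d → ℝ) → ι) (i : ι) : Fin d → ℝ :=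
  ⨍ x in c ⁻¹' {i}, x ∂μ

theorem integral_comp_cell [IsFiniteMeasure μ] (hc : Measurable c) (f : ι → ℝ) :
    ∫ x, f (c x) ∂μ = ∑ i, μ.real (c ⁻¹' {i}) * f i := by
  rw [← integral_map hc.aemeasurable (f := f)
    (measurable_of_finite f).aestronglyMeasurable, integral_fintype .of_finite]
  simp [measureReal_def, Measure.map_apply hc (measurableSet_singleton _)]

theorem sum_cell_measure [IsProbabilityMeasure μ] (hc : Measurable c) :
    ∑ i, μ.real (c ⁻¹' {i}) = 1 := by
  simpa using (integral_comp_cell (μ := μ) hc fun _ => 1).symm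

theorem integral_eq_sum_cells {f : (Fin d → ℝ) → ℝ} (hc : Measurable c) (hf : Integrable f μ) :
    ∫ x, f x ∂μ = ∑ i, ∫ x in c ⁻¹' {i}, f x ∂μ := by
  rw [← integral_iUnion_fintype (fun i => hc (measurableSet_singleton i))
    (fun i j hij => Disjoint.preimage c (by simpa using hij)) fun _ => hf.integrableOn,
    ← Set.preimage_iUnion, Set.iUnion_of_singleton, Set.preimage_univ, setIntegral_univ]

theorem sum_cellMean_le [IsProbabilityMeasure μ] (hc : Measurable c)
    (hμ : Integrable (fun x => x) μ) (hpos : ∀ i, 0 < μ.real (c ⁻¹' {i}))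
    {f : ι → (Fin d → ℝ) → ℝ} (hf : ∀ i, ConvexOn ℝ Set.univ (f i))
    (hint : Integrable (fun x => f (c x) x) μ) :
    ∑ i, μ.real (c ⁻¹' {i}) * f i (cellMean μ c i) ≤ ∫ x, f (c x) x ∂μ := by
  rw [integral_eq_sum_cells hc hint]
  refine Finset.sum_le_sum fun i _ => ?_
  have hms : MeasurableSet (c ⁻¹' {i}) := hc (measurableSet_singleton i)
  have hEq : Set.EqOn (fun x => f (c x) x) (f i) (c ⁻¹' {i}) := fun x hx => by
    simp only [Set.mem_preimage, Set.mem_singleton_iff] at hx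
    simp only [hx]
  have hi : IntegrableOn (f i) (c ⁻¹' {i}) μ := hint.integrableOn.congr_fun hEq hms
  have hne : μ (c ⁻¹' {i}) ≠ 0 := fun h => by
    have := hpos i
    simp [measureReal_def, h] at this
  have := (hf i).map_set_average_le (hf i).continuous_of_univ.continuousOn isClosed_univ hne
    (measure_ne_top _ _) (Filter.Eventually.of_forall fun _ => Set.mem_univ _)
    hμ.integrableOn hi
  rw [setAverage_eq μ (f i), smul_eq_mul] at this
  rw [setIntegral_congr_fun hms hEq]
  calc _ ≤ _ := mul_le_mul_of_nonneg_left this (hpos i).le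
    _ = _ := by rw [← mul_assoc, mul_inv_cancel₀ (hpos i).ne', one_mul]

theorem integral_norm_cellMean_rpow_le [IsProbabilityMeasure μ] (hc : Measurable c) {t : ℝ}
    (ht : 1 ≤ t) (hμ : Integrable (fun x => x) μ) (hpos : ∀ i, 0 < μ.real (c ⁻¹' {i}))
    {y : ι → Fin d → ℝ} (hint : Integrable (fun x => ‖x - y (c x)‖ ^ t) μ) :
    ∫ x, ‖cellMean μ c (c x) - y (c x)‖ ^ t ∂μ ≤ ∫ x, ‖x - y (c x)‖ ^ t ∂μ := by
  rw [integral_comp_cell hc fun i => ‖cellMean μ c i - y i‖ ^ t]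
  refine sum_cellMean_le hc hμ hpos (f := fun i x => ‖x - y i‖ ^ t) (fun i => ?_) hint
  simpa [Function.comp_def, sub_eq_add_neg] using (convexOn_norm_rpow ht).translate_left (-y i)

theorem integral_norm_sub_cellMean_rpow_le [IsProbabilityMeasure μ] (hc : Measurable c) {t : ℝ}
    (ht : 1 ≤ t) (hμ : Integrable (fun x => x) μ) (hpos : ∀ i, 0 < μ.real (c ⁻¹' {i}))
    {y : ι → Fin d → ℝ} (hint : Integrable (fun x => ‖x - y (c x)‖ ^ t) μ) :
    ∫ x, ‖x - cellMean μ c (c x)‖ ^ t ∂μ ≤ 2 ^ t * (2 * ∫ x, ‖x - y (c x)‖ ^ t ∂μ) := by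
  have hint' : Integrable (fun x => ‖cellMean μ c (c x) - y (c x)‖ ^ t) μ :=
    (Integrable.of_finite (μ := μ.map c)
      (f := fun i => ‖cellMean μ c i - y i‖ ^ t)).comp_measurable hc
  have hle := integral_norm_cellMean_rpow_le hc ht hμ hpos hint
  calc ∫ x, ‖x - cellMean μ c (c x)‖ ^ t ∂μ
      ≤ ∫ x, 2 ^ t * (‖x - y (c x)‖ ^ t + ‖cellMean μ c (c x) - y (c x)‖ ^ t) ∂μ := by
        refine integral_mono_of_nonneg (Filter.Eventually.of_forall fun x => by positivity)
          ((hint.add hint').const_mul _) (Filter.Eventually.of_forall fun x => ?_)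
        simpa using norm_sub_rpow_le ht (x - y (c x)) (cellMean μ c (c x) - y (c x))
    _ = 2 ^ t * (∫ x, ‖x - y (c x)‖ ^ t ∂μ + ∫ x, ‖cellMean μ c (c x) - y (c x)‖ ^ t ∂μ) := by
        rw [integral_const_mul, integral_add hint hint']
    _ ≤ _ := by gcongr; linarith

end Cells

theorem exists_simpleFunc_integral_le {μ : Measure (Fin d → ℝ)} [IsProbabilityMeasure μ] {t η : ℝ}
    (ht : 1 ≤ t) (hμ : Integrable (fun x => ‖x‖ ^ t) μ) (hη : 0 < η) :
    ∃ s : SimpleFunc (Fin d → ℝ) (Fin d → ℝ), Integrable (fun x => ‖x - s x‖ ^ t) μ ∧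
      ∫ x, ‖x - s x‖ ^ t ∂μ ≤ η := by
  have ht0 : 0 < t := zero_lt_one.trans_le ht
  have hp0 : ENNReal.ofReal t ≠ 0 := by simpa using ht0
  have hpt : (ENNReal.ofReal t).toReal = t := ENNReal.toReal_ofReal ht0.le
  have hid : MemLp (fun x : Fin d → ℝ => x) (ENNReal.ofReal t) μ :=
    (integrable_norm_rpow_iff aestronglyMeasurable_id hp0 ENNReal.ofReal_ne_top).1
      (by simpa only [hpt, id] using hμ)
  obtain ⟨s, hs, hsp⟩ := hid.exists_simpleFunc_eLpNorm_sub_lt ENNReal.ofReal_ne_top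
    (ε := ENNReal.ofReal (η ^ t⁻¹)) (by simpa using Real.rpow_pos_of_pos hη _)
  have hsub := hid.sub hsp
  have hint := (integrable_norm_rpow_iff hsub.1 hp0 ENNReal.ofReal_ne_top).2 hsub
  rw [hsub.eLpNorm_eq_integral_rpow_norm hp0 ENNReal.ofReal_ne_top, hpt,
    ENNReal.ofReal_lt_ofReal_iff (by positivity)] at hs
  rw [hpt] at hint
  refine ⟨s, hint, ?_⟩
  exact ((Real.rpow_lt_rpow_iff (integral_nonneg fun x => by positivity) hη.le
    (inv_pos.2 ht0)).1 hs).le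

/-- A probability measure with finite `t`-th moment is close to its cell means along some finite
partition into cells of positive mass. -/
theorem exists_cells {μ : Measure (Fin d → ℝ)} [IsProbabilityMeasure μ] {t η : ℝ}
    (ht : 1 ≤ t) (hμ : Integrable (fun x => ‖x‖ ^ t) μ) (hμ1 : Integrable (fun x => x) μ)
    (hη : 0 < η) :
    ∃ (S : Finset (Fin d → ℝ)) (c : (Fin d → ℝ) → S), Measurable c ∧
      (∀ i, 0 < μ.real (c ⁻¹' {i})) ∧ ∫ x, ‖x - cellMean μ c (c x)‖ ^ t ∂μ ≤ η := by
  classical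
  obtain ⟨s, hint, hs⟩ := exists_simpleFunc_integral_le (η := η / (2 ^ t * 2)) ht hμ (by positivity)
  set S := s.range.filter fun y => 0 < μ.real (s ⁻¹' {y}) with hS
  have hbad : ∀ᵐ x ∂μ, s x ∈ S := by
    have h : ∀ᵐ x ∂μ, ∀ y ∈ s.range \ S, s x ≠ y := by
      rw [Finset.eventually_all]
      intro y hy
      simp only [hS, Finset.mem_sdiff, Finset.mem_filter, not_and, not_lt] at hy
      have h0 : μ.real (s ⁻¹' {y}) = 0 := le_antisymm (hy.2 hy.1) measureReal_nonneg
      rw [ae_iff]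
      simpa [measureReal_def, ENNReal.toReal_eq_zero_iff, Set.preimage] using h0
    filter_upwards [h] with x hx
    by_contra hxS
    exact hx (s x) (Finset.mem_sdiff.2 ⟨s.mem_range_self x, hxS⟩) rfl
  obtain ⟨x₀, hx₀⟩ := hbad.exists
  set c : (Fin d → ℝ) → S := fun x => if h : s x ∈ S then ⟨s x, h⟩ else ⟨s x₀, hx₀⟩ with hc
  have hcm : Measurable c :=
    (s.map fun y => if h : y ∈ S then (⟨y, h⟩ : S) else ⟨s x₀, hx₀⟩).measurable
  have hcs : ∀ᵐ x ∂μ, (c x : Fin d → ℝ) = s x := by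
    filter_upwards [hbad] with x hx
    simp [hc, hx]
  have hpos (i : S) : 0 < μ.real (c ⁻¹' {i}) := by
    refine (Finset.mem_filter.1 i.2).2.trans_le (measureReal_mono fun x hx => ?_)
    simp only [Set.mem_preimage, Set.mem_singleton_iff] at hx ⊢
    simp [hc, hx]
  have hae : (fun x => ‖x - c x‖ ^ t) =ᵐ[μ] fun x => ‖x - s x‖ ^ t := by
    filter_upwards [hcs] with x hx
    rw [hx]
  refine ⟨S, c, hcm, hpos, (integral_norm_sub_cellMean_rpow_le hcm ht hμ1 hpos
    (y := fun i => i) (hint.congr hae.symm)).trans ?_⟩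
  rw [integral_congr_ae hae]
  calc _ ≤ 2 ^ t * (2 * (η / (2 ^ t * 2))) := by gcongr
    _ = η := by field_simp

/-! ### Couplings from partitions of unity -/

section OfWeight

variable {ι : Type*} [Fintype ι] [MeasurableSpace ι] [MeasurableSingletonClass ι]
  {μ ν : ProbabilityMeasure (Fin d → ℝ)} {c : (Fin d → ℝ) → ι} {g : ι → (Fin d → ℝ) → ℝ}

/-- The kernel sending `x` in the cell `i` to the measure with `ν`-density `g i / μ (c = i)`. -/
def cellKernel (μ ν : Measure (Fin d → ℝ)) (g : ι → (Fin d → ℝ) → ℝ) (hc : Measurable c) :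
    Kernel (Fin d → ℝ) (Fin d → ℝ) :=
  (Kernel.ofFunOfCountable fun i =>
    ν.withDensity fun y => ENNReal.ofReal (g i y / μ.real (c ⁻¹' {i}))).comap c hc

theorem cellKernel_apply (μ ν : Measure (Fin d → ℝ)) (hc : Measurable c) (x : Fin d → ℝ) :
    cellKernel μ ν g hc x =
      ν.withDensity fun y => ENNReal.ofReal (g (c x) y / μ.real (c ⁻¹' {c x})) := rfl

theorem isMarkovKernel_cellKernel (hg : IsWeightFamily g) (hc : Measurable c)
    (hpos : ∀ i, 0 < (μ : Measure (Fin d → ℝ)).real (c ⁻¹' {i}))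
    (hmass : ∀ i, ∫ y, g i y ∂(ν : Measure (Fin d → ℝ)) =
      (μ : Measure (Fin d → ℝ)).real (c ⁻¹' {i})) :
    IsMarkovKernel (cellKernel (μ : Measure (Fin d → ℝ)) ν g hc) where
  isProbabilityMeasure x := by
    constructor
    rw [cellKernel_apply, withDensity_apply _ MeasurableSet.univ, setLIntegral_univ,
      ← ofReal_integral_eq_lintegral_ofReal ((hg.integrable _).div_const _)
        (Filter.Eventually.of_forall fun y => div_nonneg (hg.nonneg _ y) (hpos _).le),
      integral_div, hmass, div_self (hpos _).ne', ENNReal.ofReal_one]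

theorem bind_cellKernel (hg : IsWeightFamily g) (hc : Measurable c)
    (hpos : ∀ i, 0 < (μ : Measure (Fin d → ℝ)).real (c ⁻¹' {i})) :
    (μ : Measure (Fin d → ℝ)).bind (cellKernel (μ : Measure (Fin d → ℝ)) ν g hc) =
      (ν : Measure (Fin d → ℝ)) := by
  ext s hs
  rw [Measure.bind_apply hs (Kernel.aemeasurable _)]
  simp only [cellKernel_apply, withDensity_apply _ hs]
  rw [← lintegral_map (f := fun i => ∫⁻ y in s, ENNReal.ofReal
      (g i y / (μ : Measure (Fin d → ℝ)).real (c ⁻¹' {i})) ∂(ν : Measure (Fin d → ℝ)))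
    (measurable_of_finite _) hc, lintegral_fintype]
  have hterm (i : ι) : (∫⁻ y in s, ENNReal.ofReal
      (g i y / (μ : Measure (Fin d → ℝ)).real (c ⁻¹' {i})) ∂(ν : Measure (Fin d → ℝ))) *
      (μ : Measure (Fin d → ℝ)).map c {i} =
      ∫⁻ y in s, ENNReal.ofReal (g i y) ∂(ν : Measure (Fin d → ℝ)) := by
    rw [Measure.map_apply hc (measurableSet_singleton i), mul_comm,
      ← lintegral_const_mul _ ((hg.measurable i).div_const _).ennreal_ofReal]
    refine lintegral_congr fun y => ?_
    rw [← ofReal_measureReal, ← ENNReal.ofReal_mul (hpos i).le, mul_div_cancel₀ _ (hpos i).ne']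
  simp only [hterm]
  rw [← lintegral_finsetSum _ fun i _ => (hg.measurable i).ennreal_ofReal]
  simp only [← ENNReal.ofReal_sum_of_nonneg fun i _ => hg.nonneg i _, hg.sum_eq_one]
  simp

theorem exists_coupling_of_weight (hg : IsWeightFamily g) (hc : Measurable c)
    (hpos : ∀ i, 0 < (μ : Measure (Fin d → ℝ)).real (c ⁻¹' {i}))
    (hmass : ∀ i, ∫ y, g i y ∂(ν : Measure (Fin d → ℝ)) =
      (μ : Measure (Fin d → ℝ)).real (c ⁻¹' {i})) :
    ∃ π, IsCoupling μ ν π ∧ ∀ᵐ x ∂(μ : Measure (Fin d → ℝ)), bary π x =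
      ((μ : Measure (Fin d → ℝ)).real (c ⁻¹' {c x}))⁻¹ •
        ∫ y, g (c x) y • y ∂(ν : Measure (Fin d → ℝ)) := by
  have := isMarkovKernel_cellKernel hg hc hpos hmass
  set κ := cellKernel (μ : Measure (Fin d → ℝ)) ν g hc with hκ
  refine ⟨⟨(μ : Measure (Fin d → ℝ)) ⊗ₘ κ, inferInstance⟩, ⟨?_, ?_⟩, ?_⟩
  · exact Measure.fst_compProd _ _
  · exact (Measure.snd_compProd _ _).trans (bind_cellKernel hg hc hpos)
  · have h := eq_condKernel_of_measure_eq_compProd (ρ := (μ : Measure (Fin d → ℝ)) ⊗ₘ κ) κ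
      (by rw [Measure.fst_compProd])
    rw [Measure.fst_compProd] at h
    filter_upwards [h] with x hx
    change ∫ y, y ∂(((μ : Measure (Fin d → ℝ)) ⊗ₘ κ).condKernel x) = _
    rw [← hx, hκ, cellKernel_apply,
      integral_withDensity_eq_integral_toReal_smul
        ((hg.measurable _).div_const _).ennreal_ofReal (by simp), ← integral_smul]
    refine integral_congr_ae (Filter.Eventually.of_forall fun y => ?_)
    simp only
    rw [ENNReal.toReal_ofReal (div_nonneg (hg.nonneg _ y) (hpos _).le), div_eq_inv_mul, mul_smul]

end OfWeight

/-! ### Strong duality -/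

section StrongDuality

variable {t K c₀ : ℝ} {θ : (Fin d → ℝ) → ℝ} {μ ν : ProbabilityMeasure (Fin d → ℝ)}

theorem Theta_le_of_shift (ht : 1 ≤ t) (hc₀ : ∀ x, c₀ ≤ θ x) (hθ : ConvexOn ℝ Set.univ θ)
    (hK0 : 0 ≤ K) (hK : ∀ x, |θ x| ≤ K * (1 + ‖x‖ ^ t)) {δ : ℝ} (hδ : 0 < δ) (hδ1 : δ ≤ 1)
    (x z b : Fin d → ℝ) :
    Theta θ (x - b) ≤ (1 - δ) * Theta θ (z - b) +
      δ * (K * (1 + 2 ^ t * (2 ^ t * (‖z‖ ^ t + ‖b‖ ^ t) + (δ ^ t)⁻¹ * ‖x - z‖ ^ t))) := by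
  have h1 := (convexOn_Theta hc₀ hθ).2 (Set.mem_univ (z - b))
    (Set.mem_univ (z - b + δ⁻¹ • (x - z))) (sub_nonneg.2 hδ1) hδ.le (sub_add_cancel 1 δ)
  have e : (1 - δ) • (z - b) + δ • (z - b + δ⁻¹ • (x - z)) = x - b := by
    rw [smul_add, smul_inv_smul₀ hδ.ne']
    module
  rw [e, smul_eq_mul, smul_eq_mul] at h1
  refine h1.trans (add_le_add_right (mul_le_mul_of_nonneg_left ?_ hδ.le) _)
  refine (Theta_le_self hc₀ _).trans ((le_abs_self _).trans ((hK _).trans ?_))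
  gcongr
  refine (norm_add_rpow_le ht _ _).trans ?_
  gcongr
  · exact norm_sub_rpow_le ht _ _
  · rw [norm_smul, Real.mul_rpow (norm_nonneg _) (norm_nonneg _), norm_inv,
      Real.norm_of_nonneg hδ.le, Real.inv_rpow hδ.le]

theorem le_sum_Theta_of_weight {ι : Type*} [Fintype ι] [MeasurableSpace ι]
    [MeasurableSingletonClass ι] {c : (Fin d → ℝ) → ι} (ht : 1 ≤ t) (hμ : MomT t μ)
    (hν : MomT t ν) (hc₀ : ∀ x, c₀ ≤ θ x) (hθ : ConvexOn ℝ Set.univ θ) (hK0 : 0 ≤ K)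
    (hK : ∀ x, |θ x| ≤ K * (1 + ‖x‖ ^ t)) {v : ℝ}
    (hv : ∀ π, IsCoupling μ ν π →
      v ≤ ∫ x, Theta θ (x - bary π x) ∂(μ : Measure (Fin d → ℝ)))
    {δ : ℝ} (hδ : 0 < δ) (hδ1 : δ ≤ 1) (hc : Measurable c)
    (hpos : ∀ i, 0 < (μ : Measure (Fin d → ℝ)).real (c ⁻¹' {i}))
    (hclose : ∫ x, ‖x - cellMean (μ : Measure (Fin d → ℝ)) c (c x)‖ ^ t
      ∂(μ : Measure (Fin d → ℝ)) ≤ δ ^ t)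
    {g : ι → (Fin d → ℝ) → ℝ} (hg : IsWeightFamily g)
    (hmass : ∀ i, ∫ y, g i y ∂(ν : Measure (Fin d → ℝ)) =
      (μ : Measure (Fin d → ℝ)).real (c ⁻¹' {i})) :
    v ≤ ∑ i, (μ : Measure (Fin d → ℝ)).real (c ⁻¹' {i}) *
        Theta θ (cellMean (μ : Measure (Fin d → ℝ)) c i -
          ((μ : Measure (Fin d → ℝ)).real (c ⁻¹' {i}))⁻¹ •
            ∫ y, g i y • y ∂(ν : Measure (Fin d → ℝ))) +
      δ * (K * (1 + 2 ^ t * (2 ^ t * (∫ x, ‖x‖ ^ t ∂(μ : Measure (Fin d → ℝ)) +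
        ∫ y, ‖y‖ ^ t ∂(ν : Measure (Fin d → ℝ))) + 1)) + |c₀|) := by
  obtain ⟨π, hπ, hb⟩ := exists_coupling_of_weight hg hc hpos hmass
  have hcomp (f : ι → ℝ) : Integrable (fun x => f (c x)) (μ : Measure (Fin d → ℝ)) :=
    (Integrable.of_finite (μ := (μ : Measure (Fin d → ℝ)).map c) (f := f)).comp_measurable hc
  set z := cellMean (μ : Measure (Fin d → ℝ)) c
  set b : ι → Fin d → ℝ := fun i => ((μ : Measure (Fin d → ℝ)).real (c ⁻¹' {i}))⁻¹ •
            ∫ y, g i y • y ∂(ν : Measure (Fin d → ℝ))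
  have hbary := hπ.integrable_comp_bary (hν.mom1 ht) (convexOn_norm_rpow ht) hν
  have hz : ∫ x, ‖z (c x)‖ ^ t ∂(μ : Measure (Fin d → ℝ)) ≤
      ∫ x, ‖x‖ ^ t ∂(μ : Measure (Fin d → ℝ)) := by
    simpa using integral_norm_cellMean_rpow_le hc ht (hμ.mom1 ht).integrable_id hpos
      (y := fun _ => 0) (by simpa [MomT] using hμ)
  have hxz : Integrable (fun x => ‖x - z (c x)‖ ^ t) (μ : Measure (Fin d → ℝ)) :=
    integrable_norm_sub_rpow ht aestronglyMeasurable_id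
      ((measurable_of_finite z).comp hc).aestronglyMeasurable hμ (hcomp fun i => ‖z i‖ ^ t)
  have hΘ : (fun x => Theta θ (z (c x) - bary π x)) =ᵐ[(μ : Measure (Fin d → ℝ))]
      fun x => Theta θ (z (c x) - b (c x)) := by
    filter_upwards [hb] with x hx
    rw [hx]
  have hΘi : Integrable (fun x => Theta θ (z (c x) - bary π x)) (μ : Measure (Fin d → ℝ)) :=
    (hcomp fun i => Theta θ (z i - b i)).congr hΘ.symm
  have hΘJ := (integral_congr_ae hΘ).trans (integral_comp_cell hc fun i => Theta θ (z i - b i))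
  have hJ : c₀ ≤ ∫ x, Theta θ (z (c x) - bary π x) ∂(μ : Measure (Fin d → ℝ)) := by
    simpa using integral_mono (integrable_const c₀) hΘi fun x => le_Theta fun _ _ => hc₀ _
  have hi1 := ((hcomp fun i => ‖z i‖ ^ t).add hbary.1).const_mul (2 ^ t)
  have hi2 := hxz.const_mul (δ ^ t)⁻¹
  have hi3 := (hi1.add hi2).const_mul (2 ^ t)
  have hi4 := (integrable_const (μ := (μ : Measure (Fin d → ℝ))) (1 : ℝ)).add hi3
  have hi5 := (hi4.const_mul K).const_mul δ
  have hi6 := hΘi.const_mul (1 - δ)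
  have key := integral_mono (integrable_Theta_comp hc₀ hθ (X := fun x => x - bary π x)
    (aestronglyMeasurable_id.sub (hπ.integrable_bary (hν.mom1 ht)).1)
    (hπ.integrable_theta_sub_bary ht hμ hν hθ.continuous_of_univ hK)) (hi6.add hi5)
    fun x => Theta_le_of_shift ht hc₀ hθ hK0 hK hδ hδ1 x (z (c x)) (bary π x)
  rw [integral_add' hi6 hi5, integral_const_mul, integral_const_mul, integral_const_mul,
    integral_add' (integrable_const _) hi3, integral_const_mul, integral_add' hi1 hi2,
    integral_const_mul, integral_const_mul, integral_add' (hcomp fun i => ‖z i‖ ^ t) hbary.1] at key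
  simp only [integral_const, probReal_univ, one_smul] at key
  have hδt : (δ ^ t)⁻¹ * ∫ x, ‖x - z (c x)‖ ^ t ∂(μ : Measure (Fin d → ℝ)) ≤ 1 := by
    rw [inv_mul_le_iff₀ (by positivity), mul_one]
    exact hclose
  rw [← hΘJ]
  have hD : K * (1 + 2 ^ t * (2 ^ t * (∫ x, ‖z (c x)‖ ^ t ∂(μ : Measure (Fin d → ℝ)) +
      ∫ x, ‖bary π x‖ ^ t ∂(μ : Measure (Fin d → ℝ))) +
        (δ ^ t)⁻¹ * ∫ x, ‖x - z (c x)‖ ^ t ∂(μ : Measure (Fin d → ℝ)))) ≤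
      K * (1 + 2 ^ t * (2 ^ t * (∫ x, ‖x‖ ^ t ∂(μ : Measure (Fin d → ℝ)) +
        ∫ y, ‖y‖ ^ t ∂(ν : Measure (Fin d → ℝ))) + 1)) := by
    gcongr
    exact hbary.2
  have := mul_le_mul_of_nonneg_left hD hδ.le
  have := mul_le_mul_of_nonneg_left ((neg_abs_le c₀).trans hJ) hδ.le
  linarith [hv π hπ]

theorem exists_cells_forall_weight (ht : 1 ≤ t) (hμ : MomT t μ)
    (hν : MomT t ν) (hc₀ : ∀ x, c₀ ≤ θ x) (hθ : ConvexOn ℝ Set.univ θ) (hK0 : 0 ≤ K)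
    (hK : ∀ x, |θ x| ≤ K * (1 + ‖x‖ ^ t)) {v ε : ℝ}
    (hv : ∀ π, IsCoupling μ ν π →
      v ≤ ∫ x, Theta θ (x - bary π x) ∂(μ : Measure (Fin d → ℝ))) (hε : 0 < ε) :
    ∃ (S : Finset (Fin d → ℝ)) (c : (Fin d → ℝ) → S), Measurable c ∧
      (∀ i, 0 < (μ : Measure (Fin d → ℝ)).real (c ⁻¹' {i})) ∧
      ∀ g : S → (Fin d → ℝ) → ℝ, IsWeightFamily g →
        (∀ i, ∫ y, g i y ∂(ν : Measure (Fin d → ℝ)) =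
          (μ : Measure (Fin d → ℝ)).real (c ⁻¹' {i})) →
        v - ε ≤ ∑ i, (μ : Measure (Fin d → ℝ)).real (c ⁻¹' {i}) *
          Theta θ (cellMean (μ : Measure (Fin d → ℝ)) c i -
            ((μ : Measure (Fin d → ℝ)).real (c ⁻¹' {i}))⁻¹ •
              ∫ y, g i y • y ∂(ν : Measure (Fin d → ℝ))) := by
  set D := K * (1 + 2 ^ t * (2 ^ t * (∫ x, ‖x‖ ^ t ∂(μ : Measure (Fin d → ℝ)) +
        ∫ y, ‖y‖ ^ t ∂(ν : Measure (Fin d → ℝ))) + 1)) + |c₀| with hD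
  have hD0 : 0 ≤ D := by positivity
  have hδ : 0 < min 1 (ε / (D + 1)) := by positivity
  obtain ⟨S, c, hc, hpos, hclose⟩ := exists_cells (η := min 1 (ε / (D + 1)) ^ t) ht hμ
    (hμ.mom1 ht).integrable_id (by positivity)
  refine ⟨S, c, hc, hpos, fun g hg hmass => ?_⟩
  have h1 := le_sum_Theta_of_weight ht hμ hν hc₀ hθ hK0 hK hv hδ (min_le_left _ _) hc hpos hclose
    hg hmass
  have h2 : min 1 (ε / (D + 1)) * D ≤ ε := by
    calc _ ≤ ε / (D + 1) * (D + 1) := by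
          gcongr
          · exact min_le_right _ _
          · linarith
      _ = ε := by field_simp
  linarith

theorem exists_dual_ge (ht : 1 ≤ t) (hμ : MomT t μ)
    (hν : MomT t ν) (hc₀ : ∀ x, c₀ ≤ θ x) (hθ : ConvexOn ℝ Set.univ θ)
    (hK : ∀ x, |θ x| ≤ K * (1 + ‖x‖ ^ t)) {v ε : ℝ}
    (hv : ∀ π, IsCoupling μ ν π →
      v ≤ ∫ x, Theta θ (x - bary π x) ∂(μ : Measure (Fin d → ℝ))) (hε : 0 < ε) :
    ∃ φ : (Fin d → ℝ) → ℝ, Monotone φ ∧ ConvexOn ℝ Set.univ φ ∧ Continuous φ ∧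
      (∃ K : ℝ, ∀ y, |φ y| ≤ K * (1 + ‖y‖ ^ t)) ∧
      ((v - 3 * ε : ℝ) : EReal) ≤ -((∫ y, φ y ∂(ν : Measure (Fin d → ℝ)) : ℝ) : EReal) +
          eIntE (μ : Measure (Fin d → ℝ)) (Rtheta θ φ) := by
  classical
  have hK0 : 0 ≤ K := by
    have := (abs_nonneg _).trans (hK 0)
    exact nonneg_of_mul_nonneg_left this (by positivity)
  obtain ⟨S, c, hc, hpos, hw⟩ := exists_cells_forall_weight ht hμ hν hc₀ hθ hK0 hK hv hε
  have : Nonempty S := ⟨c 0⟩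
  set m : S → ℝ := fun i => (μ : Measure (Fin d → ℝ)).real (c ⁻¹' {i}) with hm
  set z := cellMean (μ : Measure (Fin d → ℝ)) c with hz
  set J : (S → Fin d → ℝ) → ℝ := fun B => ∑ i, m i * Theta θ (z i - (m i)⁻¹ • B i) with hJ
  have hΘ := convexOn_Theta hc₀ hθ
  have hm1 : ∑ i, m i = 1 := sum_cell_measure hc
  obtain ⟨a, l, hl, hal⟩ := exists_multiplier (J := J) (hν.mom1 ht).integrable_id hpos hm1
    (by
      refine ⟨convex_univ, fun A _ B _ r s hr hs hrs => ?_⟩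
      simp only [hJ, smul_eq_mul, Finset.mul_sum, ← Finset.sum_add_distrib]
      refine Finset.sum_le_sum fun i _ => ?_
      have h1 := hΘ.2 (Set.mem_univ (z i - (m i)⁻¹ • A i)) (Set.mem_univ (z i - (m i)⁻¹ • B i))
        hr hs hrs
      have e : r • (z i - (m i)⁻¹ • A i) + s • (z i - (m i)⁻¹ • B i) =
          z i - (m i)⁻¹ • (r • A + s • B) i := by
        obtain rfl : s = 1 - r := by linarith
        rw [Pi.add_apply, Pi.smul_apply, Pi.smul_apply]
        module
      rw [e, smul_eq_mul, smul_eq_mul] at h1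
      linarith [mul_le_mul_of_nonneg_left h1 (hpos i).le])
    (continuous_finsetSum _ fun i _ => continuous_const.mul (hΘ.continuous_of_univ.comp
      (by fun_prop : Continuous fun B : S → Fin d → ℝ => z i - (m i)⁻¹ • B i)))
    (fun A B hAB => Finset.sum_le_sum fun i _ => mul_le_mul_of_nonneg_left
      (Theta_mono hc₀ (sub_le_sub_left
        (smul_le_smul_of_nonneg_left (hAB i) (inv_nonneg.2 (hpos i).le)) _)) (hpos i).le)
    hε hw
  set φ := maxAffine a l with hφ
  have hφm : Monotone φ := maxAffine_mono a l hl
  have hφc : ConvexOn ℝ Set.univ φ := convexOn_maxAffine a l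
  have hy (y : S → Fin d → ℝ) : v - 2 * ε + ∫ w, φ w ∂(ν : Measure (Fin d → ℝ)) ≤
      ∑ i, m i * (φ (y i) + θ (z i - y i)) := by
    have h1 := hal fun i => m i • y i
    have h2 : J (fun i => m i • y i) + ∑ i, (m i * a i + l i (m i • y i)) ≤
        ∑ i, m i * (φ (y i) + θ (z i - y i)) := by
      rw [hJ, ← Finset.sum_add_distrib]
      refine Finset.sum_le_sum fun i _ => ?_
      rw [inv_smul_smul₀ (hpos i).ne', map_smul, smul_eq_mul]
      linarith [mul_le_mul_of_nonneg_left (Theta_le_self hc₀ (z i - y i)) (hpos i).le,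
        mul_le_mul_of_nonneg_left (le_maxAffine a l i (y i)) (hpos i).le]
    linarith
  let i₀ : S := c 0
  have hb₀ : BddBelow (Set.range fun y => φ y + θ (z i₀ - y)) := by
    refine ⟨(v - 2 * ε + ∫ w, φ w ∂(ν : Measure (Fin d → ℝ)) -
      ∑ i ∈ Finset.univ.erase i₀, m i * (φ 0 + θ (z i))) / m i₀, ?_⟩
    rintro _ ⟨y, rfl⟩
    have h1 := hy (Function.update 0 i₀ y)
    rw [← Finset.add_sum_erase _ _ (Finset.mem_univ i₀), Function.update_self,
      Finset.sum_congr rfl (g := fun i => m i * (φ 0 + θ (z i)))] at h1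
    · rw [div_le_iff₀ (hpos i₀)]
      linarith
    · intro i hi
      simp [Function.update_of_ne (Finset.ne_of_mem_erase hi)]
  have hb := bddBelow_infConv_integrand hφc hθ hb₀
  have hr := convexOn_infConv hφc hθ hb
  have hri := integrable_infConv hφc hθ hb (hμ.mom1 ht) (hμ.integrable hθ.continuous_of_univ hK)
  refine ⟨φ, hφm, hφc, hφc.continuous_of_univ, ⟨(∑ i, (‖l i‖ + |a i|)) * 2, fun y => ?_⟩, ?_⟩
  · refine (abs_maxAffine_le a l y).trans ?_
    rw [mul_assoc]
    refine mul_le_mul_of_nonneg_left ?_ (Finset.sum_nonneg fun i _ => by positivity)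
    linarith [norm_le_one_add_rpow ht y, Real.rpow_nonneg (norm_nonneg y) t]
  · rw [show Rtheta θ φ = fun x => (infConv θ φ x : EReal) from
      funext fun x => Rtheta_eq_coe hφm (hb x), eIntE_coe, eInt_eq_coe_integral hri,
      ← EReal.coe_neg, ← EReal.coe_add, EReal.coe_le_coe_iff]
    have hsel (i : S) : ∃ y, φ y + θ (z i - y) < infConv θ φ (z i) + ε :=
      exists_lt_of_ciInf_lt (lt_add_of_pos_right _ hε)
    choose y hyε using hsel
    have h1 : ∑ i, m i * (φ (y i) + θ (z i - y i)) ≤ ∑ i, m i * infConv θ φ (z i) + ε := by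
      calc _ ≤ ∑ i, m i * (infConv θ φ (z i) + ε) :=
            Finset.sum_le_sum fun i _ => mul_le_mul_of_nonneg_left (hyε i).le (hpos i).le
        _ = _ := by
            simp only [mul_add, Finset.sum_add_distrib, ← Finset.sum_mul, hm1, one_mul]
    have h2 := sum_cellMean_le hc (hμ.mom1 ht).integrable_id hpos (f := fun _ => infConv θ φ)
      (fun _ => hr) hri
    linarith [hy y]

end StrongDuality

/-- The multiple-good monopoly problem (Theorem 6.1): the four optimization problems
(i) weak transport with cost `C_{θ,icx}`, (ii) transport after relaxing `ν` downwards in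
increasing convex order, (iii) transport relaxing both marginals, (iv) the dual problem over
increasing convex functions of `t`-growth, all have the same value. -/
theorem multiple_good_monopoly
    (t : ℝ) (ht : 1 ≤ t)
    (μ ν : ProbabilityMeasure (Fin d → ℝ)) (hμ : MomT t μ) (hν : MomT t ν)
    (θ : (Fin d → ℝ) → ℝ) (hθcont : Continuous θ) (hθconv : ConvexOn ℝ Set.univ θ)
    (hθbdd : ∃ c : ℝ, ∀ x, c ≤ θ x) (hθgrowth : ∃ K : ℝ, ∀ x, |θ x| ≤ K * (1 + ‖x‖ ^ t)) :
    (⨅ (π : ProbabilityMeasure ((Fin d → ℝ) × (Fin d → ℝ))) (_ : IsCoupling μ ν π),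
        eInt (μ : Measure (Fin d → ℝ))
          (fun x => Cicx θ x
            ⟨(π : Measure ((Fin d → ℝ) × (Fin d → ℝ))).condKernel x, inferInstance⟩)) =
      (⨅ (ν' : ProbabilityMeasure (Fin d → ℝ)) (_ : Mom1 ν') (_ : IcxLE ν' ν)
          (π : ProbabilityMeasure ((Fin d → ℝ) × (Fin d → ℝ))) (_ : IsCoupling μ ν' π),
        eInt (π : Measure ((Fin d → ℝ) × (Fin d → ℝ))) (fun z => θ (z.1 - z.2))) ∧
    (⨅ (ν' : ProbabilityMeasure (Fin d → ℝ)) (_ : Mom1 ν') (_ : IcxLE ν' ν)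
          (π : ProbabilityMeasure ((Fin d → ℝ) × (Fin d → ℝ))) (_ : IsCoupling μ ν' π),
        eInt (π : Measure ((Fin d → ℝ) × (Fin d → ℝ))) (fun z => θ (z.1 - z.2))) =
      (⨅ (μ' : ProbabilityMeasure (Fin d → ℝ)) (_ : Mom1 μ') (_ : IcxLE μ μ')
          (ν' : ProbabilityMeasure (Fin d → ℝ)) (_ : Mom1 ν') (_ : IcxLE ν' ν)
          (π : ProbabilityMeasure ((Fin d → ℝ) × (Fin d → ℝ))) (_ : IsCoupling μ' ν' π),
        eInt (π : Measure ((Fin d → ℝ) × (Fin d → ℝ))) (fun z => θ (z.1 - z.2))) ∧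
    (⨅ (π : ProbabilityMeasure ((Fin d → ℝ) × (Fin d → ℝ))) (_ : IsCoupling μ ν π),
        eInt (μ : Measure (Fin d → ℝ))
          (fun x => Cicx θ x
            ⟨(π : Measure ((Fin d → ℝ) × (Fin d → ℝ))).condKernel x, inferInstance⟩)) =
      (⨆ (φ : (Fin d → ℝ) → ℝ) (_ : Monotone φ) (_ : ConvexOn ℝ Set.univ φ)
          (_ : Continuous φ) (_ : ∃ K : ℝ, ∀ y, |φ y| ≤ K * (1 + ‖y‖ ^ t)),
        (-((∫ y, φ y ∂(ν : Measure (Fin d → ℝ)) : ℝ) : EReal) +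
          eIntE (μ : Measure (Fin d → ℝ)) (Rtheta θ φ))) := by
  obtain ⟨c₀, hc₀⟩ := hθbdd
  obtain ⟨K, hK⟩ := hθgrowth
  have h12 := le_iInf₂ fun π (hπ : IsCoupling μ ν π) =>
    (relaxed_le_weak hπ ht hμ hν hc₀ hθconv hK).trans_eq (hπ.eInt_Cicx ht hμ hν hc₀ hθconv hK).symm
  have h23 := iInf₂_le_of_le (f := fun (μ' : ProbabilityMeasure (Fin d → ℝ)) (_ : Mom1 μ') =>
    ⨅ (_ : IcxLE μ μ')
          (ν' : ProbabilityMeasure (Fin d → ℝ)) (_ : Mom1 ν') (_ : IcxLE ν' ν)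
          (π : ProbabilityMeasure ((Fin d → ℝ) × (Fin d → ℝ))) (_ : IsCoupling μ' ν' π),
        eInt (π : Measure ((Fin d → ℝ) × (Fin d → ℝ))) (fun z => θ (z.1 - z.2))) μ (hμ.mom1 ht)
    (iInf_le_of_le (fun _ _ _ _ => le_rfl) le_rfl)
  have h34 : (⨆ (φ : (Fin d → ℝ) → ℝ) (_ : Monotone φ) (_ : ConvexOn ℝ Set.univ φ)
          (_ : Continuous φ) (_ : ∃ K : ℝ, ∀ y, |φ y| ≤ K * (1 + ‖y‖ ^ t)),
        (-((∫ y, φ y ∂(ν : Measure (Fin d → ℝ)) : ℝ) : EReal) +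
          eIntE (μ : Measure (Fin d → ℝ)) (Rtheta θ φ))) ≤
      (⨅ (μ' : ProbabilityMeasure (Fin d → ℝ)) (_ : Mom1 μ') (_ : IcxLE μ μ')
          (ν' : ProbabilityMeasure (Fin d → ℝ)) (_ : Mom1 ν') (_ : IcxLE ν' ν)
          (π : ProbabilityMeasure ((Fin d → ℝ) × (Fin d → ℝ))) (_ : IsCoupling μ' ν' π),
        eInt (π : Measure ((Fin d → ℝ) × (Fin d → ℝ))) (fun z => θ (z.1 - z.2))) := by
    simp only [iSup_le_iff, le_iInf_iff]
    rintro μ' hμ' hμμ' ν' hν' hνν' π hπ φ hφm hφ hφc ⟨L, hL⟩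
    exact dual_le_primal hc₀ hθconv hφm hφ (hμ.mom1 ht) (hν.mom1 ht) hμ' hν'
      (hμ.integrable hθcont hK) (hν.integrable hφc hL) hμμ' hνν' hπ
  have h41 : (⨅ (π : ProbabilityMeasure ((Fin d → ℝ) × (Fin d → ℝ))) (_ : IsCoupling μ ν π),
        eInt (μ : Measure (Fin d → ℝ))
          (fun x => Cicx θ x
            ⟨(π : Measure ((Fin d → ℝ) × (Fin d → ℝ))).condKernel x, inferInstance⟩)) ≤
      (⨆ (φ : (Fin d → ℝ) → ℝ) (_ : Monotone φ) (_ : ConvexOn ℝ Set.univ φ)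
          (_ : Continuous φ) (_ : ∃ K : ℝ, ∀ y, |φ y| ≤ K * (1 + ‖y‖ ^ t)),
        (-((∫ y, φ y ∂(ν : Measure (Fin d → ℝ)) : ℝ) : EReal) +
          eIntE (μ : Measure (Fin d → ℝ)) (Rtheta θ φ))) := by
    by_contra! hlt
    obtain ⟨w, hw, hwlt⟩ := EReal.lt_iff_exists_real_btwn.1 hlt
    obtain ⟨v, hwv, hv⟩ := EReal.lt_iff_exists_real_btwn.1 hwlt
    rw [EReal.coe_lt_coe_iff] at hwv
    obtain ⟨φ, hφm, hφ, hφc, hL, hge⟩ := exists_dual_ge ht hμ hν hc₀ hθconv hK (v := v)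
      (ε := (v - w) / 3) (fun π hπ => EReal.coe_le_coe_iff.1 (hv.le.trans
        ((iInf₂_le π hπ).trans_eq (hπ.eInt_Cicx ht hμ hν hc₀ hθconv hK)))) (by linarith)
    rw [show v - 3 * ((v - w) / 3) = w by ring] at hge
    refine (hge.trans ?_).not_gt hw
    exact le_iSup_of_le φ (le_iSup_of_le hφm (le_iSup_of_le hφ (le_iSup_of_le hφc
      (le_iSup_of_le hL le_rfl))))
  exact ⟨(h41.trans (h34.trans h23)).antisymm h12, (h12.trans (h41.trans h34)).antisymm h23,
    h41.antisymm (h34.trans (h23.trans h12))⟩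

end
end

section
/- Let |·| be a norm on ℝ^d and μ, ν ∈ P_1(ℝ^d). Then inf_{π ∈ Π(μ,ν)} ∫_{ℝ^d} ( inf_{ z ≤ ∫ y π_x(dy) } | x − z | ) μ(dx) = sup_φ ( μ(φ) − ν(φ) ), where the supremum is over all functions φ : ℝ^d → ℝ that are bounded from below, increasing for the coordinatewise order, convex, of at most linear growth, and 1-Lipschitz with respect to |·|. -/
open MeasureTheory ProbabilityTheory ENNReal NNReal

noncomputable section

variable {d : ℕ}

section MonotoneEnvelope

/-- The least value of a seminorm above `v` in the coordinatewise order. -/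
def monotoneEnvelope (N : Seminorm ℝ (Fin d → ℝ)) (v : Fin d → ℝ) : ℝ :=
  ⨅ w : {w : Fin d → ℝ // v ≤ w}, N w.1

/-- The class of potentials in the dual problem. -/
def IsAdmissible (N : Seminorm ℝ (Fin d → ℝ)) (φ : (Fin d → ℝ) → ℝ) : Prop :=
  (∃ c : ℝ, ∀ x, c ≤ φ x) ∧ Monotone φ ∧ ConvexOn ℝ Set.univ φ ∧
    (∃ K : ℝ, ∀ x, |φ x| ≤ K * (1 + ‖x‖)) ∧
    (∀ a b : Fin d → ℝ, |φ a - φ b| ≤ N (a - b))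

variable (N : Seminorm ℝ (Fin d → ℝ))

lemma Seminorm.exists_le_mul_norm : ∃ C : ℝ, 0 < C ∧ ∀ v, N v ≤ C * ‖v‖ := by
  refine ⟨1 + ∑ i, N (Pi.single i 1), by positivity, fun v => ?_⟩
  have h1 : N v ≤ ∑ i, N (Pi.single i (v i)) := by
    conv_lhs => rw [← Finset.univ_sum_single v]
    exact Finset.le_sum_of_subadditive N (map_zero N).le (map_add_le_add N) _ _
  have h2 : ∀ i, N (Pi.single i (v i)) ≤ N (Pi.single i 1) * ‖v‖ := fun i => by
    have : (Pi.single i (v i) : Fin d → ℝ) = v i • Pi.single i 1 := by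
      rw [← Pi.single_smul]; simp
    rw [this, map_smul_eq_mul, mul_comm]
    exact mul_le_mul_of_nonneg_left (norm_le_pi_norm v i) (apply_nonneg _ _)
  calc N v ≤ ∑ i, N (Pi.single i 1) * ‖v‖ := h1.trans (Finset.sum_le_sum fun i _ => h2 i)
    _ ≤ (1 + ∑ i, N (Pi.single i 1)) * ‖v‖ := by
      rw [← Finset.sum_mul, add_mul]
      linarith [norm_nonneg v]

lemma Seminorm.continuous_of_pi : Continuous N := by
  obtain ⟨C, hC, h⟩ := N.exists_le_mul_norm
  refine (LipschitzWith.of_dist_le_mul (K := C.toNNReal) fun a b => ?_).continuous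
  rw [Real.dist_eq, dist_eq_norm, Real.coe_toNNReal _ hC.le]
  exact (abs_sub_map_le_sub N a b).trans (h _)

lemma iInf_le_eq_monotoneEnvelope (x b : Fin d → ℝ) :
    (⨅ z : {z : Fin d → ℝ // z ≤ b}, N (x - z.1)) = monotoneEnvelope N (x - b) := by
  let e : {z : Fin d → ℝ // z ≤ b} ≃ {w : Fin d → ℝ // x - b ≤ w} :=
    { toFun := fun z => ⟨x - z.1, sub_le_sub_left z.2 x⟩
      invFun := fun w => ⟨x - w.1, sub_le_comm.1 w.2⟩
      left_inv := fun z => by simp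
      right_inv := fun w => by simp }
  exact e.iInf_congr fun z => rfl

variable {N}

lemma monotoneEnvelope_le {v w : Fin d → ℝ} (h : v ≤ w) : monotoneEnvelope N v ≤ N w :=
  ciInf_le ⟨0, by rintro _ ⟨w, rfl⟩; exact apply_nonneg _ _⟩ (⟨w, h⟩ : {w // v ≤ w})

lemma le_monotoneEnvelope {v : Fin d → ℝ} {c : ℝ} (h : ∀ w, v ≤ w → c ≤ N w) :
    c ≤ monotoneEnvelope N v := by
  have : Nonempty {w : Fin d → ℝ // v ≤ w} := ⟨⟨v, le_rfl⟩⟩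
  exact le_ciInf fun w => h w.1 w.2

lemma monotoneEnvelope_nonneg (v : Fin d → ℝ) : 0 ≤ monotoneEnvelope N v :=
  le_monotoneEnvelope fun _ _ => apply_nonneg _ _

lemma monotoneEnvelope_zero : monotoneEnvelope N 0 = 0 :=
  le_antisymm ((monotoneEnvelope_le le_rfl).trans (map_zero N).le) (monotoneEnvelope_nonneg _)

lemma monotone_monotoneEnvelope : Monotone (monotoneEnvelope N) := fun _ _ h =>
  le_monotoneEnvelope fun _ hw => monotoneEnvelope_le (h.trans hw)

lemma monotoneEnvelope_add_le (u v : Fin d → ℝ) :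
    monotoneEnvelope N (u + v) ≤ monotoneEnvelope N u + monotoneEnvelope N v := by
  rw [← sub_le_iff_le_add]
  refine le_monotoneEnvelope fun a ha => ?_
  rw [sub_le_comm]
  refine le_monotoneEnvelope fun b hb => ?_
  rw [sub_le_iff_le_add']
  exact (monotoneEnvelope_le (add_le_add ha hb)).trans (map_add_le_add N a b)

lemma monotoneEnvelope_smul_le {c : ℝ} (hc : 0 ≤ c) (v : Fin d → ℝ) :
    monotoneEnvelope N (c • v) ≤ c * monotoneEnvelope N v := by
  rcases hc.eq_or_lt with rfl | hc'
  · simp [monotoneEnvelope_zero]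
  rw [← div_le_iff₀' hc']
  refine le_monotoneEnvelope fun w hw => ?_
  rw [div_le_iff₀' hc']
  refine (monotoneEnvelope_le (smul_le_smul_of_nonneg_left hw hc)).trans ?_
  rw [map_smul_eq_mul, Real.norm_of_nonneg hc]

lemma convexOn_monotoneEnvelope : ConvexOn ℝ Set.univ (monotoneEnvelope N) :=
  ⟨convex_univ, fun u _ v _ _ _ ha hb _ => (monotoneEnvelope_add_le _ _).trans
    (add_le_add (monotoneEnvelope_smul_le ha u) (monotoneEnvelope_smul_le hb v))⟩

lemma monotoneEnvelope_sub_le (u v : Fin d → ℝ) :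
    monotoneEnvelope N u - monotoneEnvelope N v ≤ N (u - v) := by
  have h := monotoneEnvelope_add_le (N := N) (u - v) v
  rw [sub_add_cancel] at h
  linarith [monotoneEnvelope_le (N := N) (le_refl (u - v))]

lemma continuous_monotoneEnvelope : Continuous (monotoneEnvelope N) := by
  obtain ⟨C, hC, h⟩ := N.exists_le_mul_norm
  refine (LipschitzWith.of_le_add_mul C.toNNReal fun a b => ?_).continuous
  rw [dist_eq_norm, Real.coe_toNNReal _ hC.le]
  linarith [monotoneEnvelope_sub_le (N := N) a b, h (a - b)]

lemma sub_le_monotoneEnvelope {φ : (Fin d → ℝ) → ℝ} (hφ : IsAdmissible N φ)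
    (x b : Fin d → ℝ) : φ x - φ b ≤ monotoneEnvelope N (x - b) := by
  refine le_monotoneEnvelope fun w hw => ?_
  have h1 := hφ.2.1 (sub_le_comm.1 hw)
  have h2 := (le_abs_self _).trans (hφ.2.2.2.2 x (x - w))
  rw [_root_.sub_sub_cancel] at h2
  linarith

lemma IsAdmissible.continuous {φ : (Fin d → ℝ) → ℝ} (hφ : IsAdmissible N φ) :
    Continuous φ := by
  obtain ⟨C, hC, h⟩ := N.exists_le_mul_norm
  refine (LipschitzWith.of_dist_le_mul (K := C.toNNReal) fun a b => ?_).continuous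
  rw [Real.dist_eq, dist_eq_norm, Real.coe_toNNReal _ hC.le]
  exact (hφ.2.2.2.2 a b).trans (h _)

lemma IsAdmissible.integrable {φ : (Fin d → ℝ) → ℝ} (hφ : IsAdmissible N φ)
    {μ : Measure (Fin d → ℝ)} [IsFiniteMeasure μ] (hμ : Integrable (fun x => ‖x‖) μ) :
    Integrable φ μ := by
  obtain ⟨K, hK⟩ := hφ.2.2.2.1
  exact Integrable.mono' (((integrable_const (1 : ℝ)).add hμ).const_mul K)
    hφ.continuous.aestronglyMeasurable (Filter.Eventually.of_forall hK)

lemma isAdmissible_zero : IsAdmissible N (fun _ => 0) :=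
  ⟨⟨0, fun _ => le_rfl⟩, monotone_const, convexOn_const _ convex_univ, ⟨0, by simp⟩, by simp⟩

lemma Seminorm.integrable_sub {α : Type*} [MeasurableSpace α] {μ : Measure α}
    {f g : α → Fin d → ℝ} (hf : Integrable f μ) (hg : Integrable g μ) :
    Integrable (fun a => N (f a - g a)) μ := by
  obtain ⟨C, hC, h⟩ := N.exists_le_mul_norm
  refine Integrable.mono' ((hf.sub hg).norm.const_mul C)
    (N.continuous_of_pi.comp_aestronglyMeasurable (hf.sub hg).1)
    (Filter.Eventually.of_forall fun a => ?_)
  rw [Real.norm_of_nonneg (apply_nonneg _ _)]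
  exact h _

end MonotoneEnvelope

section FiniteDuality

variable {N : Seminorm ℝ (Fin d → ℝ)} {J : Type*} [Fintype J]

/-- The infimal convolution over the simplex of prescribed values `ψ` at the points `y`
with the monotone envelope of `N`, presented through minimizers, is admissible. -/
lemma isAdmissible_of_isLeast (y : J → Fin d → ℝ) (ψ : J → ℝ) {φ : (Fin d → ℝ) → ℝ}
    (hφ : ∀ x, IsLeast ((fun l : J → ℝ => ∑ j, l j * ψ j +
      monotoneEnvelope N (x - ∑ j, l j • y j)) '' stdSimplex ℝ J) (φ x)) :
    IsAdmissible N φ := by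
  have hle : ∀ x, ∀ l ∈ stdSimplex ℝ J,
      φ x ≤ ∑ j, l j * ψ j + monotoneEnvelope N (x - ∑ j, l j • y j) := fun x l hl =>
    (hφ x).2 ⟨l, hl, rfl⟩
  choose L hL hLφ using fun x => (hφ x).1
  have hsub : ∀ a b, φ a - φ b ≤ N (a - b) := fun a b => by
    have h1 := hle a (L b) (hL b)
    have h2 := hLφ b
    have h3 := monotoneEnvelope_sub_le (N := N) (a - ∑ j, L b j • y j) (b - ∑ j, L b j • y j)
    rw [sub_sub_sub_cancel_right] at h3
    dsimp only at h2
    linarith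
  have hlip : ∀ a b, |φ a - φ b| ≤ N (a - b) := fun a b => by
    refine abs_sub_le_iff.2 ⟨hsub a b, ?_⟩
    rw [map_sub_rev]
    exact hsub b a
  refine ⟨⟨-∑ j, |ψ j|, fun x => ?_⟩, fun a b hab => ?_, ⟨convex_univ, ?_⟩, ?_, hlip⟩
  · have h1 := hLφ x
    dsimp only at h1
    have h2 : ∀ j ∈ Finset.univ, -|ψ j| ≤ L x j * ψ j := fun j hj => by
      have h0 := (hL x).1 j
      have h1 : L x j ≤ 1 := by
        rw [← (hL x).2]
        exact Finset.single_le_sum (fun j _ => (hL x).1 j) hj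
      nlinarith [neg_abs_le (ψ j), abs_nonneg (ψ j)]
    have h3 := Finset.sum_le_sum h2
    rw [Finset.sum_neg_distrib] at h3
    linarith [monotoneEnvelope_nonneg (N := N) (x - ∑ j, L x j • y j)]
  · have h1 := hle a (L b) (hL b)
    have h2 := hLφ b
    have h3 := monotone_monotoneEnvelope (N := N)
      (sub_le_sub_right hab (∑ j, L b j • y j))
    dsimp only at h2
    linarith
  · intro a _ b _ s t hs ht hst
    have h1 := hle (s • a + t • b) (s • L a + t • L b)
      (convex_stdSimplex ℝ J (hL a) (hL b) hs ht hst)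
    have h2 := (convexOn_monotoneEnvelope (N := N)).2 (Set.mem_univ (a - ∑ j, L a j • y j))
      (Set.mem_univ (b - ∑ j, L b j • y j)) hs ht hst
    have h3 : s • a + t • b - ∑ j, (s • L a + t • L b) j • y j =
        s • (a - ∑ j, L a j • y j) + t • (b - ∑ j, L b j • y j) := by
      simp only [Pi.add_apply, Pi.smul_apply, add_smul, Finset.sum_add_distrib, smul_eq_mul,
        mul_smul, smul_sub, Finset.smul_sum]
      abel
    have h4 : ∑ j, (s • L a + t • L b) j * ψ j =
        s * ∑ j, L a j * ψ j + t * ∑ j, L b j * ψ j := by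
      simp only [Pi.add_apply, Pi.smul_apply, add_mul, Finset.sum_add_distrib, smul_eq_mul,
        mul_assoc, Finset.mul_sum]
    have ha := hLφ a
    have hb := hLφ b
    dsimp only at ha hb
    rw [h3, h4] at h1
    rw [← ha, ← hb]
    simp only [smul_eq_mul] at h2 ⊢
    linarith
  · obtain ⟨C, hC, h⟩ := N.exists_le_mul_norm
    refine ⟨C + |φ 0|, fun x => ?_⟩
    have h1 := hlip x 0
    rw [sub_zero] at h1
    have h2 : |φ x| ≤ |φ x - φ 0| + |φ 0| := by
      simpa using abs_add_le (φ x - φ 0) (φ 0)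
    nlinarith [h x, norm_nonneg x, abs_nonneg (φ 0), mul_nonneg (abs_nonneg (φ 0)) (norm_nonneg x)]

variable {I : Type*} [Fintype I]

open scoped Pointwise in
/-- Duality for finitely supported marginals. -/
theorem exists_stochastic_matrix_of_forall_isAdmissible {p : I → ℝ} (hp : p ∈ stdSimplex ℝ I)
    {q : J → ℝ} (hq : q ∈ stdSimplex ℝ J) (x : I → Fin d → ℝ) (y : J → Fin d → ℝ) {V : ℝ}
    (hV : ∀ φ, IsAdmissible N φ → ∑ i, p i * φ (x i) - ∑ j, q j * φ (y j) ≤ V) :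
    ∃ l : I → J → ℝ, (∀ i, l i ∈ stdSimplex ℝ J) ∧ (∀ j, ∑ i, p i * l i j = q j) ∧
      ∑ i, p i * monotoneEnvelope N (x i - ∑ j, l i j • y j) ≤ V := by
  classical
  set S : Set (I → J → ℝ) := Set.univ.pi fun _ => stdSimplex ℝ J
  have hScomp : IsCompact S := isCompact_univ_pi fun _ => isCompact_stdSimplex ℝ J
  have hSconv : Convex ℝ S := convex_pi fun _ _ => convex_stdSimplex ℝ J
  let A : (I → J → ℝ) → J → ℝ := fun l j => ∑ i, p i * l i j
  let F : (I → J → ℝ) → ℝ := fun l =>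
    ∑ i, p i * monotoneEnvelope N (x i - ∑ j, l i j • y j)
  have hAcont : Continuous A := by fun_prop
  have hFcont : Continuous F := by
    refine continuous_finsetSum _ fun i _ => continuous_const.mul
      (continuous_monotoneEnvelope.comp ?_)
    fun_prop
  let C : Set ((J → ℝ) × ℝ) := {c | ∃ l ∈ S, c.1 = A l ∧ F l ≤ c.2}
  have hCclosed : IsClosed C := by
    have : C = (fun l => (A l, F l)) '' S + ({0} : Set (J → ℝ)) ×ˢ Set.Ici (0 : ℝ) := by
      ext ⟨r, t⟩
      simp only [C, Set.mem_ofPred_eq, Set.mem_add, Set.mem_image, Set.mem_prod,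
        Set.mem_singleton_iff, Set.mem_Ici]
      constructor
      · rintro ⟨l, hl, h1, h2⟩
        exact ⟨_, ⟨l, hl, rfl⟩, (0, t - F l), ⟨rfl, sub_nonneg.2 h2⟩, by simp [h1]⟩
      · rintro ⟨_, ⟨l, hl, rfl⟩, ⟨r', t'⟩, ⟨h1, h2⟩, h3⟩
        simp only [Prod.mk_add_mk, Prod.mk.injEq] at h1 h2 h3
        exact ⟨l, hl, by rw [← h3.1, h1, add_zero], by linarith [h3.2]⟩
    rw [this]
    exact (isClosed_singleton.prod isClosed_Ici).add_left_of_isCompact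
      (hScomp.image (hAcont.prodMk hFcont))
  have hCconv : Convex ℝ C := by
    rintro ⟨r, t⟩ ⟨l, hl, h1, h2⟩ ⟨r', t'⟩ ⟨l', hl', h1', h2'⟩ a b ha hb hab
    refine ⟨a • l + b • l', hSconv hl hl' ha hb hab, ?_, ?_⟩
    · dsimp only at h1 h1'
      ext j
      simp only [h1, h1', A, Prod.smul_mk, Prod.mk_add_mk, Pi.add_apply, Pi.smul_apply,
        smul_eq_mul, Finset.mul_sum, ← Finset.sum_add_distrib]
      exact Finset.sum_congr rfl fun i _ => by ring
    · have key : F (a • l + b • l') ≤ a * F l + b * F l' := by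
        simp only [F, Finset.mul_sum, ← Finset.sum_add_distrib]
        refine Finset.sum_le_sum fun i _ => ?_
        have h3 : x i - ∑ j, (a • l + b • l') i j • y j =
            a • (x i - ∑ j, l i j • y j) + b • (x i - ∑ j, l' i j • y j) := by
          have : x i = a • x i + b • x i := by rw [← add_smul, hab, one_smul]
          simp only [Pi.add_apply, Pi.smul_apply, add_smul, Finset.sum_add_distrib, smul_eq_mul,
            mul_smul, smul_sub, Finset.smul_sum]
          nth_rw 1 [this]
          abel
        have h4 := (convexOn_monotoneEnvelope (N := N)).2
          (Set.mem_univ (x i - ∑ j, l i j • y j))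
          (Set.mem_univ (x i - ∑ j, l' i j • y j)) ha hb hab
        rw [h3]
        simp only [smul_eq_mul] at h4
        have := mul_le_mul_of_nonneg_left h4 (hp.1 i)
        linarith
      dsimp only at h2 h2'
      simp only [Prod.smul_mk, Prod.mk_add_mk, smul_eq_mul]
      linarith [mul_le_mul_of_nonneg_left h2 ha, mul_le_mul_of_nonneg_left h2' hb]
  by_cases hmem : (q, V) ∈ C
  · obtain ⟨l, hl, h1, h2⟩ := hmem
    exact ⟨l, fun i => hl i (Set.mem_univ i), fun j => (congrFun h1 j).symm, h2⟩
  exfalso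
  obtain ⟨f, u, hfu, hf⟩ := geometric_hahn_banach_point_closed hCconv hCclosed hmem
  set ψ : J → ℝ := fun j => f (Pi.single j 1, 0) with hψ
  set s : ℝ := f (0, 1) with hs
  have hfeq : ∀ r t, f (r, t) = ∑ j, r j * ψ j + t * s := fun r t => by
    have h1 : ((r, t) : (J → ℝ) × ℝ) =
        ∑ j, r j • ((Pi.single j 1, 0) : (J → ℝ) × ℝ) + t • ((0, 1) : (J → ℝ) × ℝ) := by
      refine Prod.ext ?_ ?_
      · ext k
        simp [Prod.fst_sum, Finset.sum_apply, Pi.single_apply]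
      · simp [Prod.snd_sum]
    rw [h1, map_add, map_sum, map_smul]
    simp only [map_smul, smul_eq_mul, hψ, hs]
  have hspos : 0 < s := by
    have hq' : A (fun _ => q) = q := by
      ext j
      simp only [A, ← Finset.sum_mul, hp.2, one_mul]
    have h1 := hf (q, F (fun _ => q) + |V - F (fun _ => q)|)
      ⟨fun _ => q, fun _ _ => hq, hq'.symm, by simp⟩
    have h2 := hfu.trans h1
    rw [hfeq, hfeq] at h2
    have h3 := le_abs_self (V - F (fun _ => q))
    by_contra! h
    nlinarith
  have hstrict : ∀ l ∈ S, V + ∑ j, q j * (ψ j / s) < ∑ j, A l j * (ψ j / s) + F l := by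
    intro l hl
    have h1 := hfu.trans (hf (A l, F l) ⟨l, hl, rfl, le_rfl⟩)
    rw [hfeq, hfeq] at h1
    have h2 := div_lt_div_of_pos_right h1 hspos
    simp only [add_div, Finset.sum_div, mul_div_cancel_right₀ _ hspos.ne'] at h2
    simp only [mul_div_assoc] at h2
    linarith
  have hmin : ∀ v : Fin d → ℝ, ∃ l ∈ stdSimplex ℝ J, IsMinOn (fun l : J → ℝ =>
      ∑ j, l j * (ψ j / s) + monotoneEnvelope N (v - ∑ j, l j • y j)) (stdSimplex ℝ J) l := by
    intro v
    refine (isCompact_stdSimplex ℝ J).exists_isMinOn ⟨q, hq⟩ (Continuous.continuousOn ?_)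
    refine Continuous.add (by fun_prop) (continuous_monotoneEnvelope.comp ?_)
    fun_prop
  choose L hL hLmin using hmin
  set φ : (Fin d → ℝ) → ℝ := fun v =>
    ∑ j, L v j * (ψ j / s) + monotoneEnvelope N (v - ∑ j, L v j • y j) with hφ
  have hadm : IsAdmissible N φ := isAdmissible_of_isLeast y (fun j => ψ j / s) fun v =>
    ⟨⟨L v, hL v, rfl⟩, by rintro _ ⟨l, hl, rfl⟩; exact hLmin v hl⟩
  have hφy : ∀ j, φ (y j) ≤ ψ j / s := fun j => by
    have := hLmin (y j) (single_mem_stdSimplex ℝ j)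
    simpa [Pi.single_apply, monotoneEnvelope_zero] using this
  have h1 := hV φ hadm
  have h2 := hstrict (fun i => L (x i)) fun i _ => hL (x i)
  have h3 : ∑ j, A (fun i => L (x i)) j * (ψ j / s) + F (fun i => L (x i)) =
      ∑ i, p i * φ (x i) := by
    simp only [A, F, hφ, mul_add, Finset.sum_add_distrib, Finset.sum_mul, Finset.mul_sum]
    rw [Finset.sum_comm]
    simp only [mul_assoc]
  have h4 : ∑ j, q j * φ (y j) ≤ ∑ j, q j * (ψ j / s) :=
    Finset.sum_le_sum fun j _ => mul_le_mul_of_nonneg_left (hφy j) (hq.1 j)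
  linarith

end FiniteDuality

section WeakDuality

variable {N : Seminorm ℝ (Fin d → ℝ)} {μ ν : ProbabilityMeasure (Fin d → ℝ)}

lemma integrable_id_of_norm {μ : Measure (Fin d → ℝ)} (hμ : Integrable (fun x => ‖x‖) μ) :
    Integrable (fun x => x) μ :=
  (integrable_norm_iff aestronglyMeasurable_id).1 hμ

/-- Every coupling has cost at least the value of every admissible potential. -/
theorem IsCoupling.ofReal_integral_sub_le
    (hμ : Integrable (fun x => ‖x‖) (μ : Measure (Fin d → ℝ)))
    (hν : Integrable (fun x => ‖x‖) (ν : Measure (Fin d → ℝ)))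
    {π : ProbabilityMeasure ((Fin d → ℝ) × (Fin d → ℝ))} (hπ : IsCoupling μ ν π)
    {φ : (Fin d → ℝ) → ℝ} (hφ : IsAdmissible N φ) :
    ENNReal.ofReal (∫ x, φ x ∂(μ : Measure (Fin d → ℝ)) - ∫ y, φ y ∂(ν : Measure (Fin d → ℝ))) ≤
      ∫⁻ x, ENNReal.ofReal (monotoneEnvelope N
        (x - ∫ y, y ∂((π : Measure ((Fin d → ℝ) × (Fin d → ℝ))).condKernel x)))
          ∂(μ : Measure (Fin d → ℝ)) := by
  obtain ⟨h1, h2⟩ := hπ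
  set ρ : Measure ((Fin d → ℝ) × (Fin d → ℝ)) := ↑π
  have hfst : ρ.fst = μ := h1
  have hφμ : Integrable φ (μ : Measure (Fin d → ℝ)) := hφ.integrable hμ
  have hφν : Integrable φ (ν : Measure (Fin d → ℝ)) := hφ.integrable hν
  have hint : ∀ {G : Type} [NormedAddCommGroup G] {f : (Fin d → ℝ) → G},
      Integrable f (ν : Measure (Fin d → ℝ)) → Integrable (fun z => f z.2) ρ := by
    intro G _ f hf
    rw [← h2] at hf
    exact hf.comp_measurable measurable_snd
  have hφρ := hint hφν
  have hidρ := hint (integrable_id_of_norm hν)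
  have hνeq : ∫ y, φ y ∂(ν : Measure (Fin d → ℝ)) =
      ∫ x, ∫ y, φ y ∂ρ.condKernel x ∂(μ : Measure (Fin d → ℝ)) := by
    have h3 := Measure.integral_condKernel hφρ
    rw [hfst] at h3
    rw [h3, ← h2]
    exact integral_map measurable_snd.aemeasurable hφ.continuous.aestronglyMeasurable
  have hKint : Integrable (fun x => ∫ y, φ y ∂ρ.condKernel x) (μ : Measure (Fin d → ℝ)) := by
    have h3 := hφρ.integral_condKernel
    rwa [hfst] at h3
  have hae1 := hφρ.condKernel_ae
  have hae2 := hidρ.condKernel_ae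
  rw [hfst] at hae1 hae2
  rw [hνeq, ← integral_sub hφμ hKint]
  have hsub := hφμ.sub hKint
  calc ENNReal.ofReal (∫ x, (φ x - ∫ y, φ y ∂ρ.condKernel x) ∂(μ : Measure (Fin d → ℝ)))
      ≤ ENNReal.ofReal (∫ x, max (φ x - ∫ y, φ y ∂ρ.condKernel x) 0
          ∂(μ : Measure (Fin d → ℝ))) := by
        exact ENNReal.ofReal_le_ofReal
          (integral_mono hsub hsub.pos_part fun x => le_max_left _ _)
    _ = ∫⁻ x, ENNReal.ofReal (max (φ x - ∫ y, φ y ∂ρ.condKernel x) 0)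
          ∂(μ : Measure (Fin d → ℝ)) :=
        ofReal_integral_eq_lintegral_ofReal hsub.pos_part
          (Filter.Eventually.of_forall fun x => le_max_right _ _)
    _ ≤ _ := by
        refine lintegral_mono_ae ?_
        filter_upwards [hae1, hae2] with x hx1 hx2
        refine ENNReal.ofReal_le_ofReal (max_le ?_ (monotoneEnvelope_nonneg _))
        have hJ := hφ.2.2.1.map_integral_le (μ := ρ.condKernel x) (f := fun y => y)
          hφ.continuous.continuousOn isClosed_univ (by simp) hx2 hx1
        linarith [sub_le_monotoneEnvelope hφ x (∫ y, y ∂ρ.condKernel x)]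

end WeakDuality

section Discretization

variable {N : Seminorm ℝ (Fin d → ℝ)}

lemma exists_simpleFunc_integral_seminorm_sub_le {μ : Measure (Fin d → ℝ)}
    [IsFiniteMeasure μ] (hμ : Integrable (fun x => ‖x‖) μ) {ε : ℝ} (hε : 0 < ε) :
    ∃ T : SimpleFunc (Fin d → ℝ) (Fin d → ℝ), ∫ x, N (x - T x) ∂μ ≤ ε := by
  obtain ⟨C, hC, hN⟩ := N.exists_le_mul_norm
  have hid := integrable_id_of_norm hμ
  obtain ⟨T, hT, hT'⟩ := (memLp_one_iff_integrable.2 hid).exists_simpleFunc_eLpNorm_sub_lt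
    ENNReal.one_ne_top (ε := ENNReal.ofReal (ε / C)) (by simp; positivity)
  have hTint : Integrable T μ := memLp_one_iff_integrable.1 hT'
  refine ⟨T, ?_⟩
  have h1 : ∫ x, ‖x - T x‖ ∂μ ≤ ε / C := by
    rw [eLpNorm_one_eq_lintegral_enorm] at hT
    have h2 := integral_norm_eq_lintegral_enorm (hid.sub hTint).1
    have h3 := ENNReal.toReal_mono ENNReal.ofReal_ne_top hT.le
    rw [ENNReal.toReal_ofReal (by positivity)] at h3
    exact h2.le.trans h3
  calc ∫ x, N (x - T x) ∂μ ≤ ∫ x, C * ‖x - T x‖ ∂μ :=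
        integral_mono (Seminorm.integrable_sub hid hTint) ((hid.sub hTint).norm.const_mul C)
          fun x => hN _
    _ ≤ ε := by
        rw [integral_const_mul]
        rwa [le_div_iff₀' hC] at h1

variable {α I : Type*} [MeasurableSpace α] [Fintype I] [MeasurableSpace I]
  [MeasurableSingletonClass I]

lemma integrable_comp_of_fintype {G : Type*} [NormedAddCommGroup G] {μ : Measure α}
    [IsFiniteMeasure μ] {T : α → I} (hT : Measurable T) (F : I → G) :
    Integrable (fun a => F (T a)) μ :=
  (Integrable.of_finite (μ := μ.map T) (f := F)).comp_measurable hT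

lemma integral_comp_of_fintype {μ : Measure α} [IsFiniteMeasure μ] {T : α → I}
    (hT : Measurable T) (F : I → ℝ) :
    ∫ a, F (T a) ∂μ = ∑ i, μ.real (T ⁻¹' {i}) * F i := by
  rw [← integral_map hT.aemeasurable (Integrable.of_finite (μ := μ.map T)).1,
    integral_fintype Integrable.of_finite]
  exact Finset.sum_congr rfl fun i _ => by
    rw [map_measureReal_apply hT (measurableSet_singleton i), smul_eq_mul]

lemma measureReal_preimage_mem_stdSimplex {μ : Measure α} [IsProbabilityMeasure μ] {T : α → I}
    (hT : Measurable T) : (fun i => μ.real (T ⁻¹' {i})) ∈ stdSimplex ℝ I := by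
  refine ⟨fun i => measureReal_nonneg, ?_⟩
  simpa using (integral_comp_of_fintype (μ := μ) hT fun _ => (1 : ℝ)).symm

/-- Conditional measures on the cells of a partition, chosen to be probability measures also on
negligible cells. -/
lemma exists_isProbabilityMeasure_smul_eq_restrict {ν : Measure (Fin d → ℝ)}
    [IsFiniteMeasure ν] (hν : Integrable (fun x => x) ν) (A : Set (Fin d → ℝ)) :
    ∃ ρ : Measure (Fin d → ℝ), IsProbabilityMeasure ρ ∧ Integrable (fun x => x) ρ ∧
      ν A • ρ = ν.restrict A := by
  by_cases h : ν A = 0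
  · exact ⟨Measure.dirac 0, inferInstance, integrable_dirac (by simp), by
      rw [h, zero_smul, Measure.restrict_eq_zero.2 h]⟩
  · refine ⟨ν[|A], cond_isProbabilityMeasure h, ?_, ?_⟩
    · exact hν.restrict.smul_measure (ENNReal.inv_ne_top.2 h)
    · rw [ProbabilityTheory.cond, smul_smul, ENNReal.mul_inv_cancel h (measure_ne_top _ _),
        one_smul]

lemma sum_restrict_preimage {ν : Measure α} {S : α → I} (hS : Measurable S) :
    ∑ j, ν.restrict (S ⁻¹' {j}) = ν := by
  rw [← Measure.sum_fintype, ← Measure.restrict_iUnion]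
  · rw [← Set.preimage_iUnion, Set.iUnion_of_singleton, Set.preimage_univ, Measure.restrict_univ]
  · intro i j hij
    exact Disjoint.preimage _ (by simpa using hij)
  · exact fun j => hS (measurableSet_singleton j)

variable {J : Type*} [Fintype J] [MeasurableSpace J] [MeasurableSingletonClass J]

/-- A transport plan between finitely many cells induces a coupling whose cost is controlled by
the discrete cost and the discretization errors. -/
theorem exists_isCoupling_lintegral_le {μ ν : ProbabilityMeasure (Fin d → ℝ)}
    (hμ : Integrable (fun x => ‖x‖) (μ : Measure (Fin d → ℝ)))
    (hν : Integrable (fun x => ‖x‖) (ν : Measure (Fin d → ℝ)))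
    {T : (Fin d → ℝ) → I} (hT : Measurable T) {S : (Fin d → ℝ) → J} (hS : Measurable S)
    (x : I → Fin d → ℝ) (y : J → Fin d → ℝ) {l : I → J → ℝ}
    (hl : ∀ i, l i ∈ stdSimplex ℝ J)
    (hlν : ∀ j, ∑ i, (μ : Measure (Fin d → ℝ)).real (T ⁻¹' {i}) * l i j =
      (ν : Measure (Fin d → ℝ)).real (S ⁻¹' {j})) :
    ∃ π, IsCoupling μ ν π ∧
      ∫⁻ a, ENNReal.ofReal (monotoneEnvelope N
        (a - ∫ b, b ∂((π : Measure ((Fin d → ℝ) × (Fin d → ℝ))).condKernel a)))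
          ∂(μ : Measure (Fin d → ℝ)) ≤
      ENNReal.ofReal (∫ a, N (a - x (T a)) ∂(μ : Measure (Fin d → ℝ)) +
        ∑ i, (μ : Measure (Fin d → ℝ)).real (T ⁻¹' {i}) *
          monotoneEnvelope N (x i - ∑ j, l i j • y j) +
        ∫ b, N (y (S b) - b) ∂(ν : Measure (Fin d → ℝ))) := by
  have hidμ := integrable_id_of_norm hμ
  have hidν := integrable_id_of_norm hν
  choose ρ hρprob hρint hρ using fun j =>
    exists_isProbabilityMeasure_smul_eq_restrict hidν (S ⁻¹' {j})
  set p : I → ℝ := fun i => (μ : Measure (Fin d → ℝ)).real (T ⁻¹' {i})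
  set q : J → ℝ := fun j => (ν : Measure (Fin d → ℝ)).real (S ⁻¹' {j})
  let κ₀ : I → Measure (Fin d → ℝ) := fun i => ∑ j, ENNReal.ofReal (l i j) • ρ j
  have hκ₀prob : ∀ i, IsProbabilityMeasure (κ₀ i) := fun i => ⟨by
    simp only [κ₀, Measure.finsetSum_apply, Measure.smul_apply, measure_univ, smul_eq_mul, mul_one]
    rw [← ENNReal.ofReal_sum_of_nonneg fun j _ => (hl i).1 j, (hl i).2, ENNReal.ofReal_one]⟩
  let κ : Kernel (Fin d → ℝ) (Fin d → ℝ) := (Kernel.ofFunOfCountable κ₀).comap T hT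
  have hκ : ∀ a, κ a = κ₀ (T a) := fun a => rfl
  have : IsMarkovKernel κ := ⟨fun a => hκ₀prob (T a)⟩
  have hsnd : ((μ : Measure (Fin d → ℝ)) ⊗ₘ κ).snd = ν := by
    rw [Measure.snd_compProd]
    ext B hB
    rw [Measure.bind_apply hB κ.aemeasurable]
    simp only [hκ]
    rw [← lintegral_map (f := fun i => κ₀ i B) (measurable_of_finite _) hT, lintegral_fintype]
    simp only [Measure.map_apply hT (measurableSet_singleton _), κ₀, Measure.finsetSum_apply,
      Measure.smul_apply, smul_eq_mul, Finset.sum_mul]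
    rw [Finset.sum_comm]
    have hj : ∀ j, ∑ i, ENNReal.ofReal (l i j) * ρ j B * (μ : Measure (Fin d → ℝ)) (T ⁻¹' {i}) =
        (ν : Measure (Fin d → ℝ)).restrict (S ⁻¹' {j}) B := fun j => by
      have h1 : (ν : Measure (Fin d → ℝ)) (S ⁻¹' {j}) =
          ∑ i, (μ : Measure (Fin d → ℝ)) (T ⁻¹' {i}) * ENNReal.ofReal (l i j) := by
        rw [← ofReal_measureReal, ← hlν j,
          ENNReal.ofReal_sum_of_nonneg fun i _ => mul_nonneg measureReal_nonneg ((hl i).1 j)]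
        exact Finset.sum_congr rfl fun i _ => by
          rw [ENNReal.ofReal_mul measureReal_nonneg, ofReal_measureReal]
      rw [← hρ j, Measure.smul_apply, h1, smul_eq_mul, Finset.sum_mul]
      exact Finset.sum_congr rfl fun i _ => by ring
    simp only [hj]
    rw [← Measure.finsetSum_apply, sum_restrict_preimage hS]
  have hfst : ((μ : Measure (Fin d → ℝ)) ⊗ₘ κ).fst = μ := Measure.fst_compProd _ _
  refine ⟨⟨(μ : Measure (Fin d → ℝ)) ⊗ₘ κ, inferInstance⟩, ⟨hfst, hsnd⟩, ?_⟩
  have hcond : ∀ᵐ a ∂(μ : Measure (Fin d → ℝ)),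
      κ a = ((μ : Measure (Fin d → ℝ)) ⊗ₘ κ).condKernel a := by
    have h := eq_condKernel_of_measure_eq_compProd (ρ := (μ : Measure (Fin d → ℝ)) ⊗ₘ κ) κ
      (by rw [hfst])
    rwa [hfst] at h
  set m : J → Fin d → ℝ := fun j => ∫ b, b ∂ρ j
  set e : J → ℝ := fun j => ∫ b, N (y j - b) ∂ρ j
  have hbary : ∀ i, ∫ b, b ∂κ₀ i = ∑ j, l i j • m j := fun i => by
    rw [integral_finsetSum_measure fun j _ => (hρint j).smul_measure ENNReal.ofReal_ne_top]
    exact Finset.sum_congr rfl fun j _ => by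
      rw [integral_smul_measure, ENNReal.toReal_ofReal ((hl i).1 j)]
  have hNm : ∀ j, N (y j - m j) ≤ e j := fun j => by
    have h1 : Integrable (fun b => y j - b) (ρ j) := (integrable_const _).sub (hρint j)
    have h2 := N.convexOn.map_integral_le (μ := ρ j) (f := fun b => y j - b)
      N.continuous_of_pi.continuousOn isClosed_univ (by simp) h1
      (Seminorm.integrable_sub (integrable_const _) (hρint j))
    rwa [integral_sub (integrable_const _) (hρint j), integral_const, probReal_univ, one_smul]
      at h2
  set G : I → ℝ := fun i => monotoneEnvelope N (x i - ∑ j, l i j • y j) + ∑ j, l i j * e j with hG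
  have hpoint : ∀ a, monotoneEnvelope N (a - ∫ b, b ∂κ₀ (T a)) ≤ N (a - x (T a)) + G (T a) := by
    intro a
    set i := T a
    have h1 : a - ∑ j, l i j • m j =
        (a - x i) + (x i - ∑ j, l i j • y j) + ∑ j, l i j • (y j - m j) := by
      simp only [smul_sub, Finset.sum_sub_distrib]
      abel
    have h2 : N (∑ j, l i j • (y j - m j)) ≤ ∑ j, l i j * e j := by
      refine (Finset.le_sum_of_subadditive N (map_zero N).le (map_add_le_add N) _ _).trans
        (Finset.sum_le_sum fun j _ => ?_)
      rw [map_smul_eq_mul, Real.norm_of_nonneg ((hl i).1 j)]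
      exact mul_le_mul_of_nonneg_left (hNm j) ((hl i).1 j)
    rw [hbary, h1]
    have h3 := monotoneEnvelope_add_le (N := N) ((a - x i) + (x i - ∑ j, l i j • y j))
      (∑ j, l i j • (y j - m j))
    have h4 := monotoneEnvelope_add_le (N := N) (a - x i) (x i - ∑ j, l i j • y j)
    have h5 := monotoneEnvelope_le (N := N) (le_refl (a - x i))
    have h6 := monotoneEnvelope_le (N := N) (le_refl (∑ j, l i j • (y j - m j)))
    simp only [hG]
    linarith
  have hint1 : Integrable (fun a => N (a - x (T a))) (μ : Measure (Fin d → ℝ)) :=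
    Seminorm.integrable_sub hidμ (integrable_comp_of_fintype hT x)
  have hint2 : Integrable (fun a => G (T a)) (μ : Measure (Fin d → ℝ)) :=
    integrable_comp_of_fintype hT G
  have hint3 : Integrable (fun b => N (y (S b) - b)) (ν : Measure (Fin d → ℝ)) :=
    Seminorm.integrable_sub (integrable_comp_of_fintype hS y) hidν
  have hq_e : ∑ j, q j * e j = ∫ b, N (y (S b) - b) ∂(ν : Measure (Fin d → ℝ)) := by
    conv_rhs => rw [← sum_restrict_preimage (ν := (ν : Measure (Fin d → ℝ))) hS]
    rw [integral_finsetSum_measure fun j _ => hint3.restrict]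
    refine Finset.sum_congr rfl fun j _ => ?_
    have h1 : ∫ b in S ⁻¹' {j}, N (y (S b) - b) ∂(ν : Measure (Fin d → ℝ)) =
        ∫ b in S ⁻¹' {j}, N (y j - b) ∂(ν : Measure (Fin d → ℝ)) :=
      setIntegral_congr_fun (hS (measurableSet_singleton j)) fun b hb => by
        rw [show S b = j from hb]
    rw [h1, ← hρ j, integral_smul_measure]
    rfl
  have hG_sum : ∑ i, p i * G i =
      ∑ i, p i * monotoneEnvelope N (x i - ∑ j, l i j • y j) + ∑ j, q j * e j := by
    simp only [hG, mul_add, Finset.sum_add_distrib, Finset.mul_sum]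
    congr 1
    rw [Finset.sum_comm]
    refine Finset.sum_congr rfl fun j _ => ?_
    rw [show q j = _ from (hlν j).symm, Finset.sum_mul]
    exact Finset.sum_congr rfl fun i _ => by ring
  calc _ ≤ ∫⁻ a, ENNReal.ofReal (N (a - x (T a)) + G (T a)) ∂(μ : Measure (Fin d → ℝ)) := by
        refine lintegral_mono_ae ?_
        filter_upwards [hcond] with a ha
        refine ENNReal.ofReal_le_ofReal ?_
        have := hpoint a
        rwa [← hκ, ha] at this
    _ = ENNReal.ofReal (∫ a, (N (a - x (T a)) + G (T a)) ∂(μ : Measure (Fin d → ℝ))) :=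
        (ofReal_integral_eq_lintegral_ofReal (hint1.add hint2) (Filter.Eventually.of_forall
          fun a => (monotoneEnvelope_nonneg _).trans (hpoint a))).symm
    _ ≤ _ := by
        rw [integral_add hint1 hint2, integral_comp_of_fintype hT, hG_sum, hq_e, add_assoc]

end Discretization

/-- Kantorovich–Rubinstein-type duality for the monopolist problem (Corollary 6.2):
for a norm `N` on `ℝ^d`,
`inf_π ∫ inf_{z ≤ ∫ y π_x(dy)} N(x-z) dμ = sup_φ (μ(φ) - ν(φ))`, the supremum being over
bounded from below, increasing, convex, linear-growth functions `φ` that are `1`-Lipschitz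
with respect to `N`. -/
theorem monopolist_duality
    (N : Seminorm ℝ (Fin d → ℝ)) (hN : ∀ x, N x = 0 → x = 0)
    (μ ν : ProbabilityMeasure (Fin d → ℝ))
    (hμ : Integrable (fun x => ‖x‖) (μ : Measure (Fin d → ℝ)))
    (hν : Integrable (fun x => ‖x‖) (ν : Measure (Fin d → ℝ))) :
    (⨅ (π : ProbabilityMeasure ((Fin d → ℝ) × (Fin d → ℝ))) (_ : IsCoupling μ ν π),
        ∫⁻ x, ENNReal.ofReal
          (⨅ z : {z : Fin d → ℝ //
              z ≤ ∫ y, y ∂((π : Measure ((Fin d → ℝ) × (Fin d → ℝ))).condKernel x)},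
            N (x - z.1)) ∂(μ : Measure (Fin d → ℝ))) =
      ENNReal.ofReal
        (⨆ φ : {φ : (Fin d → ℝ) → ℝ //
            (∃ c : ℝ, ∀ x, c ≤ φ x) ∧ Monotone φ ∧ ConvexOn ℝ Set.univ φ ∧
              (∃ K : ℝ, ∀ x, |φ x| ≤ K * (1 + ‖x‖)) ∧
              (∀ a b : Fin d → ℝ, |φ a - φ b| ≤ N (a - b))},
          (∫ x, φ.1 x ∂(μ : Measure (Fin d → ℝ)) -
            ∫ y, φ.1 y ∂(ν : Measure (Fin d → ℝ)))) := by
  simp only [iInf_le_eq_monotoneEnvelope]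
  have hidμ := integrable_id_of_norm hμ
  have hidν := integrable_id_of_norm hν
  change _ = ENNReal.ofReal (⨆ φ : {φ // IsAdmissible N φ},
    (∫ x, φ.1 x ∂(μ : Measure (Fin d → ℝ)) - ∫ y, φ.1 y ∂(ν : Measure (Fin d → ℝ))))
  have : Nonempty {φ // IsAdmissible N φ} := ⟨⟨_, isAdmissible_zero⟩⟩
  have hbdd : BddAbove (Set.range fun φ : {φ // IsAdmissible N φ} =>
      (∫ x, φ.1 x ∂(μ : Measure (Fin d → ℝ)) - ∫ y, φ.1 y ∂(ν : Measure (Fin d → ℝ)))) := by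
    refine ⟨∫ x, N (x - 0) ∂(μ : Measure (Fin d → ℝ)) +
      ∫ y, N (0 - y) ∂(ν : Measure (Fin d → ℝ)), ?_⟩
    rintro _ ⟨⟨φ, hφ⟩, rfl⟩
    have h1 : ∫ x, (φ x - φ 0) ∂(μ : Measure (Fin d → ℝ)) ≤
        ∫ x, N (x - 0) ∂(μ : Measure (Fin d → ℝ)) :=
      integral_mono ((hφ.integrable hμ).sub (integrable_const _))
        (Seminorm.integrable_sub hidμ (integrable_const _))
        fun x => (le_abs_self _).trans (hφ.2.2.2.2 x 0)
    have h2 : ∫ y, (φ 0 - φ y) ∂(ν : Measure (Fin d → ℝ)) ≤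
        ∫ y, N (0 - y) ∂(ν : Measure (Fin d → ℝ)) :=
      integral_mono ((integrable_const _).sub (hφ.integrable hν))
        (Seminorm.integrable_sub (integrable_const _) hidν)
        fun y => (le_abs_self _).trans (hφ.2.2.2.2 0 y)
    rw [integral_sub (hφ.integrable hμ) (integrable_const _)] at h1
    rw [integral_sub (integrable_const _) (hφ.integrable hν)] at h2
    simp only [integral_const, probReal_univ, one_smul] at h1 h2
    dsimp only
    linarith
  set V : ℝ := ⨆ φ : {φ // IsAdmissible N φ},
    (∫ x, φ.1 x ∂(μ : Measure (Fin d → ℝ)) - ∫ y, φ.1 y ∂(ν : Measure (Fin d → ℝ)))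
  have hleV : ∀ φ, IsAdmissible N φ →
      ∫ x, φ x ∂(μ : Measure (Fin d → ℝ)) - ∫ y, φ y ∂(ν : Measure (Fin d → ℝ)) ≤ V :=
    fun φ hφ => le_ciSup hbdd ⟨φ, hφ⟩
  refine le_antisymm ?_ (le_iInf₂ fun π hπ => ?_)
  · have hε : ∀ ε : ℝ, 0 < ε → (⨅ (π : ProbabilityMeasure ((Fin d → ℝ) × (Fin d → ℝ)))
        (_ : IsCoupling μ ν π), ∫⁻ x, ENNReal.ofReal (monotoneEnvelope N
          (x - ∫ y, y ∂((π : Measure ((Fin d → ℝ) × (Fin d → ℝ))).condKernel x)))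
            ∂(μ : Measure (Fin d → ℝ))) ≤ ENNReal.ofReal (V + 4 * ε) := by
      intro ε hε
      obtain ⟨T, hT⟩ := exists_simpleFunc_integral_seminorm_sub_le (N := N) hμ hε
      obtain ⟨S, hS⟩ := exists_simpleFunc_integral_seminorm_sub_le (N := N) hν hε
      have hTm : Measurable fun a => (⟨T a, T.mem_range_self a⟩ : T.range) :=
        T.measurable.subtype_mk
      have hSm : Measurable fun a => (⟨S a, S.mem_range_self a⟩ : S.range) :=
        S.measurable.subtype_mk
      have hTi : Integrable T (μ : Measure (Fin d → ℝ)) :=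
        integrable_comp_of_fintype hTm Subtype.val
      have hSi : Integrable S (ν : Measure (Fin d → ℝ)) :=
        integrable_comp_of_fintype hSm Subtype.val
      obtain ⟨l, hl, hlν, hlV⟩ := exists_stochastic_matrix_of_forall_isAdmissible (N := N)
        (measureReal_preimage_mem_stdSimplex (μ := (μ : Measure (Fin d → ℝ))) hTm)
        (measureReal_preimage_mem_stdSimplex (μ := (ν : Measure (Fin d → ℝ))) hSm)
        Subtype.val Subtype.val (V := V + 2 * ε) (by
          intro φ hφ
          rw [← integral_comp_of_fintype hTm fun i => φ i.1,
            ← integral_comp_of_fintype hSm fun j => φ j.1]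
          have hφT : Integrable (fun a => φ (T a)) (μ : Measure (Fin d → ℝ)) :=
            integrable_comp_of_fintype hTm fun i => φ i.1
          have hφS : Integrable (fun a => φ (S a)) (ν : Measure (Fin d → ℝ)) :=
            integrable_comp_of_fintype hSm fun i => φ i.1
          have h1 : ∫ x, (φ (T x) - φ x) ∂(μ : Measure (Fin d → ℝ)) ≤
              ∫ x, N (x - T x) ∂(μ : Measure (Fin d → ℝ)) :=
            integral_mono (hφT.sub (hφ.integrable hμ)) (Seminorm.integrable_sub hidμ hTi)
              fun x => by
                dsimp only
                rw [map_sub_rev]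
                exact (le_abs_self _).trans (hφ.2.2.2.2 _ _)
          have h2 : ∫ y, (φ y - φ (S y)) ∂(ν : Measure (Fin d → ℝ)) ≤
              ∫ y, N (y - S y) ∂(ν : Measure (Fin d → ℝ)) :=
            integral_mono ((hφ.integrable hν).sub hφS) (Seminorm.integrable_sub hidν hSi)
              fun y => (le_abs_self _).trans (hφ.2.2.2.2 _ _)
          rw [integral_sub hφT (hφ.integrable hμ)] at h1
          rw [integral_sub (hφ.integrable hν) hφS] at h2
          dsimp only
          linarith [hleV φ hφ])
      obtain ⟨π, hπ, hle⟩ := exists_isCoupling_lintegral_le (N := N) hμ hν hTm hSm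
        Subtype.val Subtype.val hl hlν
      refine (iInf₂_le π hπ).trans (hle.trans (ENNReal.ofReal_le_ofReal ?_))
      have hS' : ∫ b, N (S b - b) ∂(ν : Measure (Fin d → ℝ)) ≤ ε := by
        simpa only [map_sub_rev] using hS
      dsimp only at hlV ⊢
      linarith
    have htend : Filter.Tendsto (fun ε : ℝ => ENNReal.ofReal (V + 4 * ε))
        (nhdsWithin 0 (Set.Ioi 0)) (nhds (ENNReal.ofReal V)) := by
      have h : Continuous fun ε : ℝ => ENNReal.ofReal (V + 4 * ε) :=
        ENNReal.continuous_ofReal.comp (by fun_prop)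
      simpa using (h.tendsto 0).mono_left nhdsWithin_le_nhds
    exact ge_of_tendsto htend (Filter.eventually_of_mem self_mem_nhdsWithin hε)
  · set X := ∫⁻ x, ENNReal.ofReal (monotoneEnvelope N
      (x - ∫ y, y ∂((π : Measure ((Fin d → ℝ) × (Fin d → ℝ))).condKernel x)))
        ∂(μ : Measure (Fin d → ℝ))
    by_cases hXtop : X = ∞
    · rw [hXtop]
      exact le_top
    rw [ENNReal.ofReal_le_iff_le_toReal hXtop]
    exact ciSup_le fun φ =>
      (ENNReal.ofReal_le_iff_le_toReal hXtop).1 (hπ.ofReal_integral_sub_le hμ hν φ.2)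

end
end
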